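/- arXiv:1310.4658 — 2 statements merged into one kernel-verified Lean document; each statement's English description precedes it below -/
import Mathlib

section
/- Let a ∉ {0,1} and c ∉ {0,−1,−2,…} be real numbers and 𝓕 = (F_1,F_2) a pair of finite sets of positive integers, not both empty. For every n ∈ σ_𝓕 and every real x with Ω_𝓕^{a,c}(x) ≠ 0 and Ω_𝓕^{a,c}(x+1) ≠ 0, one has h_{−1}(x)·m_n^{a,c;𝓕}(x−1) + h_0(x)·m_n^{a,c;𝓕}(x) + h_1(x)·m_n^{a,c;𝓕}(x+1) = n·m_n^{a,c;𝓕}(x), where, writing Ω = Ω_𝓕^{a,c} and Λ = Λ_𝓕^{a,c}: h_{−1}(x) = x·Ω(x+1)/((a−1)·Ω(x)), h_1(x) = a·(x+c+k)·Ω(x)/((a−1)·Ω(x+1)), and h_0(x) = −((1+a)(x+k)+ac)/(a−1) + u_𝓕 + a·(x+c+k)·Λ(x+1)/((a−1)·Ω(x+1)) − a·(x+c+k−1)·Λ(x)/((a−1)·Ω(x)). -/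
open Finset MeasureTheory Polynomial

/-- Generalized binomial coefficient `C(t, j) = t(t-1)⋯(t-j+1)/j!`. -/
noncomputable def gbinom (t : ℝ) (j : ℕ) : ℝ :=
  (∏ i ∈ Finset.range j, (t - i)) / (Nat.factorial j)

/-- Pochhammer symbol `(t)_m = t(t+1)⋯(t+m-1)`. -/
noncomputable def poch (t : ℝ) (m : ℕ) : ℝ := ∏ i ∈ Finset.range m, (t + i)

/-- Pochhammer symbol with integer index (Γ-quotient convention for negative index). -/
noncomputable def pochZ (t : ℝ) (m : ℤ) : ℝ :=
  if 0 ≤ m then ∏ i ∈ Finset.range m.toNat, (t + i)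
  else (∏ i ∈ Finset.range (-m).toNat, (t - (i + 1)))⁻¹

/-- `ĉ = max(-⌊c⌋, 0)`. -/
noncomputable def chat (c : ℝ) : ℕ := (-⌊c⌋).toNat

/-- Admissibility of `c` and the pair `𝓕 = (F₁, F₂)`. -/
def IsAdmissible (c : ℝ) (F1 F2 : Finset ℕ) : Prop :=
  ∀ x : ℕ, 0 ≤ (∏ f ∈ F1, ((x : ℝ) - f)) * (∏ f ∈ F2, ((x : ℝ) + c + f)) /
    poch ((x : ℝ) + c) (chat c)

/-- `u_𝓕 = ∑_{f∈F₁} f + ∑_{f∈F₂} f - C(k₁+1, 2) - C(k₂, 2)`. -/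
def uF (F1 F2 : Finset ℕ) : ℕ :=
  (∑ f ∈ F1, f + ∑ f ∈ F2, f) - (Nat.choose (F1.card + 1) 2 + Nat.choose F2.card 2)

/-- `σ_𝓕 = {u_𝓕, u_𝓕+1, …} \ {u_𝓕 + f : f ∈ F₁}`. -/
def sigmaF (F1 F2 : Finset ℕ) : Set ℕ :=
  {n | uF F1 F2 ≤ n ∧ ∀ f ∈ F1, n ≠ uF F1 F2 + f}

/-- The `i`-th element (0-based) of `F` in increasing order. -/
def nth (F : Finset ℕ) (i : ℕ) : ℕ := (F.sort (· ≤ ·)).getD i 0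
/-- The Meixner polynomial `m_n^{a,c}` evaluated at `x`. -/
noncomputable def meixner (a c : ℝ) (n : ℕ) (x : ℝ) : ℝ :=
  (a / (1 - a)) ^ n *
    ∑ j ∈ Finset.range (n + 1), a ^ (-(j : ℤ)) * gbinom x j * gbinom (-x - c) (n - j)

/-- The polynomial `m_n^{a,c;𝓕}` (Casorati determinant of Meixner polynomials). -/
noncomputable def mExc (a c : ℝ) (F1 F2 : Finset ℕ) (n : ℕ) (x : ℝ) : ℝ :=
  Matrix.det (Matrix.of fun i j : Fin (F1.card + F2.card + 1) =>
    if (i : ℕ) = 0 then meixner a c (n - uF F1 F2) (x + ((j : ℕ) : ℝ))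
    else if (i : ℕ) - 1 < F1.card then meixner a c (nth F1 ((i : ℕ) - 1)) (x + ((j : ℕ) : ℝ))
    else a ^ (-((j : ℕ) : ℤ)) *
      meixner a⁻¹ c (nth F2 ((i : ℕ) - 1 - F1.card)) (x + ((j : ℕ) : ℝ)))

/-- The Casorati determinant `Ω_𝓕^{a,c}(x)`. -/
noncomputable def OmegaM (a c : ℝ) (F1 F2 : Finset ℕ) (x : ℝ) : ℝ :=
  Matrix.det (Matrix.of fun i j : Fin (F1.card + F2.card) =>
    if (i : ℕ) < F1.card then meixner a c (nth F1 (i : ℕ)) (x + ((j : ℕ) : ℝ))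
    else a ^ (-((j : ℕ) : ℤ)) *
      meixner a⁻¹ c (nth F2 ((i : ℕ) - F1.card)) (x + ((j : ℕ) : ℝ)))

/-- The determinant `Λ_𝓕^{a,c}(x)` (columns `0, …, k-2, k`). -/
noncomputable def LambdaM (a c : ℝ) (F1 F2 : Finset ℕ) (x : ℝ) : ℝ :=
  Matrix.det (Matrix.of fun i j : Fin (F1.card + F2.card) =>
    let col : ℕ := if (j : ℕ) = F1.card + F2.card - 1 then F1.card + F2.card else (j : ℕ)
    if (i : ℕ) < F1.card then meixner a c (nth F1 (i : ℕ)) (x + (col : ℝ))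
    else a ^ (-(col : ℤ)) *
      meixner a⁻¹ c (nth F2 ((i : ℕ) - F1.card)) (x + (col : ℝ)))
/-- The polynomial `q_n^𝓕` (Christoffel-transform dual of `m_n^{a,c;𝓕}`). -/
noncomputable def qExc (a c : ℝ) (F1 F2 : Finset ℕ) (n : ℕ) (x : ℝ) : ℝ :=
  Matrix.det (Matrix.of fun i j : Fin (F1.card + F2.card + 1) =>
    if (i : ℕ) = 0 then meixner a c (n + (j : ℕ)) (x - (uF F1 F2 : ℝ))
    else if (i : ℕ) - 1 < F1.card then
      meixner a c (n + (j : ℕ)) ((nth F1 ((i : ℕ) - 1) : ℝ))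
    else (-1 : ℝ) ^ (j : ℕ) *
      meixner a⁻¹ c (n + (j : ℕ)) ((nth F2 ((i : ℕ) - 1 - F1.card) : ℝ))) /
  ((-1 : ℝ) ^ (n * F2.card) * (∏ f ∈ F1, (x - (f : ℝ) - (uF F1 F2 : ℝ))) *
    ∏ f ∈ F2, (x + c + (f : ℝ) - (uF F1 F2 : ℝ)))

/-- The second order difference operator `D_𝓕` of Theorem 3.3. -/
noncomputable def DopM (a c : ℝ) (F1 F2 : Finset ℕ) (g : ℝ → ℝ) (x : ℝ) : ℝ :=
  (x * OmegaM a c F1 F2 (x + 1) / ((a - 1) * OmegaM a c F1 F2 x)) * g (x - 1)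
  + (-((1 + a) * (x + ((F1.card + F2.card : ℕ) : ℝ)) + a * c) / (a - 1) + (uF F1 F2 : ℝ)
      + a * (x + c + ((F1.card + F2.card : ℕ) : ℝ)) * LambdaM a c F1 F2 (x + 1) /
          ((a - 1) * OmegaM a c F1 F2 (x + 1))
      - a * (x + c + ((F1.card + F2.card : ℕ) : ℝ) - 1) * LambdaM a c F1 F2 x /
          ((a - 1) * OmegaM a c F1 F2 x)) * g x
  + (a * (x + c + ((F1.card + F2.card : ℕ) : ℝ)) * OmegaM a c F1 F2 x /
      ((a - 1) * OmegaM a c F1 F2 (x + 1))) * g (x + 1)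

/-- The weight `w(x) = aˣ Γ(x+c+k)/(x! Ω(x) Ω(x+1))` on `ℕ`. -/
noncomputable def wM (a c : ℝ) (F1 F2 : Finset ℕ) (x : ℕ) : ℝ :=
  a ^ x * Real.Gamma ((x : ℝ) + c + ((F1.card + F2.card : ℕ) : ℝ)) /
    ((Nat.factorial x : ℝ) * OmegaM a c F1 F2 (x : ℝ) * OmegaM a c F1 F2 ((x : ℝ) + 1))

lemma gbinom_zero (t : ℝ) : gbinom t 0 = 1 := by simp [gbinom]

lemma gbinom_succ (t : ℝ) (j : ℕ) :
    ((j : ℝ) + 1) * gbinom t (j + 1) = (t - j) * gbinom t j := by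
  have h1 : (Nat.factorial j : ℝ) ≠ 0 := by positivity
  have h2 : (j : ℝ) + 1 ≠ 0 := by positivity
  simp only [gbinom, Finset.prod_range_succ, Nat.factorial_succ]
  push_cast
  field_simp

lemma gbinom_shift (t : ℝ) (j : ℕ) :
    (t + 1) * gbinom t j = (t + 1 - j) * gbinom (t + 1) j := by
  induction j with
  | zero => simp [gbinom_zero]
  | succ j ih =>
    have h2 : (j : ℝ) + 1 ≠ 0 := by positivity
    apply mul_left_cancel₀ h2
    have e1 := gbinom_succ t j
    have e2 := gbinom_succ (t + 1) j
    push_cast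
    linear_combination (t + 1) * e1 - (t + 1 - (j + 1)) * e2 + (t - j) * ih

lemma gbinom_pascal (t : ℝ) (j : ℕ) :
    gbinom (t + 1) (j + 1) = gbinom t (j + 1) + gbinom t j := by
  have h2 : (j : ℝ) + 1 ≠ 0 := by positivity
  apply mul_left_cancel₀ h2
  have e1 := gbinom_succ t j
  have e2 := gbinom_succ (t + 1) j
  have e3 := gbinom_shift t j
  linear_combination e2 - e1 - e3

/-- The core sum. -/
noncomputable def mxS (b c : ℝ) (n : ℕ) (x : ℝ) : ℝ :=
  ∑ j ∈ Finset.range (n + 1), b ^ j * gbinom x j * gbinom (-x - c) (n - j)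

lemma mxS_eq (a b c : ℝ) (hab : a * b = 1) (n : ℕ) (x : ℝ) :
    x * mxS b c n (x - 1) - (x + a * (x + c)) * mxS b c n x + a * (x + c) * mxS b c n (x + 1)
      = (a - 1) * n * mxS b c n x := by
  set y := -x - c with hy
  have hA : x * mxS b c n (x - 1) = ∑ j ∈ Finset.range (n + 1),
      b ^ j * ((x - j) * gbinom x j) * gbinom y (n - j)
      + ∑ j ∈ Finset.range (n + 1), a * (b ^ j * (j * gbinom x j) * gbinom y (n - j)) := by
    have key : ∑ j ∈ Finset.range (n + 1), a * (b ^ j * (j * gbinom x j) * gbinom y (n - j))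
        = ∑ j ∈ Finset.range n, b ^ j * ((x - j) * gbinom x j) * gbinom y (n - j - 1) := by
      rw [Finset.sum_range_succ']
      simp only [Nat.cast_zero, zero_mul, mul_zero, add_zero]
      apply Finset.sum_congr rfl
      intro j _
      rw [← gbinom_succ, show n - (j + 1) = n - j - 1 by omega, pow_succ]
      push_cast
      linear_combination (b ^ j * ((j + 1) * gbinom x (j + 1)) * gbinom y (n - j - 1)) * hab
    rw [key, mxS, Finset.mul_sum, Finset.sum_range_succ, Finset.sum_range_succ]
    rw [add_right_comm, ← Finset.sum_add_distrib]
    have hxx : ∀ j : ℕ, x * gbinom (x - 1) j = (x - j) * gbinom x j := by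
      intro j
      have := gbinom_shift (x - 1) j
      simpa using this
    have hyy : -(x - 1) - c = y + 1 := by rw [hy]; ring
    rw [hyy]
    congr 1
    · apply Finset.sum_congr rfl
      intro j hj
      have hj' := Finset.mem_range.1 hj
      obtain ⟨m, hm⟩ : ∃ m, n - j = m + 1 := ⟨n - j - 1, by omega⟩
      rw [hm, gbinom_pascal, Nat.add_sub_cancel]
      linear_combination (b ^ j * (gbinom y (m + 1) + gbinom y m)) * hxx j
    · simp only [Nat.sub_self, gbinom_zero]
      linear_combination b ^ n * hxx n
  have hC : a * (x + c) * mxS b c n (x + 1) = -(∑ j ∈ Finset.range (n + 1),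
      a * (b ^ j * gbinom x j * ((y - (n - j : ℕ)) * gbinom y (n - j)))
      + ∑ j ∈ Finset.range (n + 1), b ^ j * gbinom x j * (((n - j : ℕ) : ℝ) * gbinom y (n - j))) := by
    have hyy : -(x + 1) - c = y - 1 := by rw [hy]; ring
    have hsh : ∀ m : ℕ, (x + c) * gbinom (y - 1) m = -((y - m) * gbinom y m) := by
      intro m
      have := gbinom_shift (y - 1) m
      simp only [sub_add_cancel] at this
      rw [← this, hy]; ring
    have key : ∑ j ∈ Finset.range (n + 1), b ^ j * gbinom x j * (((n - j : ℕ) : ℝ) * gbinom y (n - j))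
        = ∑ j ∈ Finset.range n,
          a * (b ^ (j + 1) * gbinom x j * ((y - (n - (j + 1) : ℕ)) * gbinom y (n - (j + 1)))) := by
      rw [Finset.sum_range_succ]
      simp only [Nat.sub_self, Nat.cast_zero, zero_mul, mul_zero, add_zero]
      apply Finset.sum_congr rfl
      intro j hj
      have hj' := Finset.mem_range.1 hj
      obtain ⟨m, hm⟩ : ∃ m, n - j = m + 1 := ⟨n - j - 1, by omega⟩
      rw [show n - (j + 1) = m by omega, hm, ← gbinom_succ, pow_succ]
      push_cast
      linear_combination -(b ^ j * gbinom x j * (((m : ℝ) + 1) * gbinom y (m + 1))) * hab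
    rw [key, mxS, Finset.mul_sum, Finset.sum_range_succ', Finset.sum_range_succ' _ n]
    rw [add_right_comm, ← Finset.sum_add_distrib, hyy, neg_add (∑ _ ∈ _, _), ← Finset.sum_neg_distrib]
    congr 1
    · apply Finset.sum_congr rfl
      intro j hj
      rw [gbinom_pascal]
      linear_combination (a * b ^ (j + 1) * (gbinom x (j + 1) + gbinom x j)) * hsh (n - (j + 1))
    · simp only [Nat.sub_zero, gbinom_zero]
      linear_combination a * b ^ 0 * hsh n
  rw [hA, hC]
  unfold mxS
  rw [← hy]
  simp only [Finset.mul_sum]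
  rw [← sub_eq_zero, ← Finset.sum_add_distrib, ← Finset.sum_add_distrib, ← sub_eq_add_neg,
    ← Finset.sum_sub_distrib, ← Finset.sum_sub_distrib, ← Finset.sum_sub_distrib]
  apply Finset.sum_eq_zero
  intro j hj
  have hj' := Finset.mem_range.1 hj
  rw [Nat.cast_sub (by omega), hy]
  ring

lemma meixner_eq (a c : ℝ) (ha0 : a ≠ 0) (n : ℕ) (x : ℝ) :
    x * meixner a c n (x - 1) - (x + a * (x + c)) * meixner a c n x
      + a * (x + c) * meixner a c n (x + 1) = (a - 1) * n * meixner a c n x := by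
  have h : ∀ t, meixner a c n t = (a / (1 - a)) ^ n * mxS a⁻¹ c n t := by
    intro t
    unfold meixner mxS
    simp only [zpow_neg, zpow_natCast, inv_pow]
  have := mxS_eq a a⁻¹ c (mul_inv_cancel₀ ha0) n x
  simp only [h]
  linear_combination (a / (1 - a)) ^ n * this

/-- Minors of the Casorati matrix. -/
noncomputable def casM {k : ℕ} (φ : Fin k → ℤ → ℝ) (j : Fin (k + 1)) (s : ℤ) : ℝ :=
  Matrix.det (Matrix.of fun i l : Fin k => φ i (s + ((j.succAbove l : ℕ) : ℤ)))

/-- Casorati operator. -/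
noncomputable def casP {k : ℕ} (φ : Fin k → ℤ → ℝ) (f : ℤ → ℝ) (s : ℤ) : ℝ :=
  ∑ j : Fin (k + 1), (-1) ^ (j : ℕ) * f (s + ((j : ℕ) : ℤ)) * casM φ j s

lemma casP_eq_det {k : ℕ} (φ : Fin k → ℤ → ℝ) (f : ℤ → ℝ) (s : ℤ) :
    casP φ f s = Matrix.det (Matrix.of fun i j : Fin (k + 1) =>
      (Fin.cons f φ : Fin (k + 1) → ℤ → ℝ) i (s + ((j : ℕ) : ℤ))) := by
  rw [Matrix.det_succ_row_zero]
  rfl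

lemma casP_self {k : ℕ} (φ : Fin k → ℤ → ℝ) (i : Fin k) (s : ℤ) : casP φ (φ i) s = 0 := by
  rw [casP_eq_det]
  apply Matrix.det_zero_of_row_eq (i := 0) (j := i.succ) (Fin.succ_ne_zero i).symm
  funext j
  simp

lemma casP_comb {k : ℕ} (φ : Fin k → ℤ → ℝ) (f : ℤ → ℝ) (α : Fin k → ℝ) (s : ℤ) :
    casP φ (fun t => f t - ∑ i, α i * φ i t) s = casP φ f s := by
  have h : casP φ (fun t => f t - ∑ i, α i * φ i t) s
      = casP φ f s - ∑ i, α i * casP φ (φ i) s := by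
    unfold casP
    simp only [Finset.mul_sum]
    rw [Finset.sum_comm, ← Finset.sum_sub_distrib]
    apply Finset.sum_congr rfl
    intro j _
    rw [mul_sub, sub_mul, Finset.mul_sum, Finset.sum_mul]
    congr 1
    apply Finset.sum_congr rfl
    intro i _
    ring
  rw [h]
  simp [casP_self]

lemma casorati_darboux {m : ℕ} (φ : Fin (m + 1) → ℤ → ℝ) (f : ℤ → ℝ) (A B C : ℤ → ℝ)
    (lam : Fin (m + 1) → ℝ) (lam0 : ℝ)
    (hφ : ∀ i t, A t * φ i (t - 1) + B t * φ i t + C t * φ i (t + 1) = lam i * φ i t)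
    (hf : ∀ t, A t * f (t - 1) + B t * f t + C t * f (t + 1) = lam0 * f t)
    (Om La : ℤ → ℝ)
    (hOm : ∀ s, Om s = Matrix.det (Matrix.of fun i l : Fin (m + 1) => φ i (s + ((l : ℕ) : ℤ))))
    (hLa : ∀ s, La s = Matrix.det (Matrix.of fun i l : Fin (m + 1) =>
      φ i (s + ((if (l : ℕ) = m then m + 1 else (l : ℕ) : ℕ) : ℤ))))
    (h0 : Om 0 ≠ 0) :
    A 0 * Om 1 ^ 2 * casP φ f (-1)
      + (B (m + 1) * Om 0 * Om 1 + C (m + 1) * La 1 * Om 0 - C m * La 0 * Om 1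
          - lam0 * Om 0 * Om 1) * casP φ f 0
      + C (m + 1) * Om 0 ^ 2 * casP φ f 1 = 0 := by
  have hM0 : ∀ s, casM φ 0 s = Om (s + 1) := by
    intro s
    rw [hOm, casM]
    congr 1
    ext i l
    simp only [Matrix.of_apply, Fin.succAbove_zero, Fin.val_succ]
    congr 1
    push_cast
    ring
  have hMl : ∀ s, casM φ (Fin.last (m + 1)) s = Om s := by
    intro s
    rw [hOm, casM]
    congr 1
    ext i l
    simp
  have hMp : ∀ s, casM φ (Fin.castSucc (Fin.last m)) s = La s := by
    intro s
    rw [hLa, casM]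
    congr 1
    ext i l
    simp only [Matrix.of_apply]
    congr 3
    by_cases hl : (l : ℕ) = m
    · have : l = Fin.last m := Fin.ext hl
      subst this
      simp [Fin.succAbove]
    · have : l < Fin.last m := Fin.lt_last_iff_ne_last.2 (fun h => hl (by simp [h]))
      simp [Fin.succAbove, this, hl]
  set N : Matrix (Fin (m + 1)) (Fin (m + 1)) ℝ :=
    Matrix.of fun i l => φ i (((l : ℕ) : ℤ)) with hN
  have hdet : IsUnit N.det := by
    rw [isUnit_iff_ne_zero]
    have := hOm 0
    simp only [zero_add] at this
    rw [hN, ← this]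
    exact h0
  set v : Fin (m + 1) → ℝ := fun l => f (((l : ℕ) : ℤ)) with hv
  set α : Fin (m + 1) → ℝ := Matrix.vecMul v N⁻¹ with hα
  have hαN : Matrix.vecMul α N = v := by
    rw [hα, Matrix.vecMul_vecMul, Matrix.nonsing_inv_mul _ hdet, Matrix.vecMul_one]
  set ψ : ℤ → ℝ := fun t => f t - ∑ i, α i * φ i t with hψ
  have hz : ∀ l : Fin (m + 1), ψ ((l : ℕ) : ℤ) = 0 := by
    intro l
    have := congrFun hαN l
    simp only [Matrix.vecMul, dotProduct, hN, Matrix.of_apply, hv] at this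
    simp only [hψ]
    rw [this, sub_self]
  have hPψ : ∀ s, casP φ f s = casP φ ψ s := fun s => (casP_comb φ f α s).symm
  have hT : lam0 * casP φ f 0
      = casP φ (fun t => A t * ψ (t - 1) + B t * ψ t + C t * ψ (t + 1)) 0 := by
    have e1 : (fun t => A t * ψ (t - 1) + B t * ψ t + C t * ψ (t + 1))
        = fun t => (lam0 * f t) - ∑ i, (α i * lam i) * φ i t := by
      funext t
      have : ∑ i, (α i * lam i) * φ i t = A t * ∑ i, α i * φ i (t - 1)
          + B t * ∑ i, α i * φ i t + C t * ∑ i, α i * φ i (t + 1) := by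
        simp only [Finset.mul_sum]
        rw [← Finset.sum_add_distrib, ← Finset.sum_add_distrib]
        apply Finset.sum_congr rfl
        intro i _
        linear_combination -(α i) * hφ i t
      rw [this, ← hf t]
      simp only [hψ]
      ring
    rw [e1, casP_comb φ (fun t => lam0 * f t) (fun i => α i * lam i) 0]
    unfold casP
    rw [Finset.mul_sum]
    apply Finset.sum_congr rfl
    intro j _
    ring
  set ε : ℝ := (-1) ^ (m + 1) with hε
  have hPm : casP φ ψ (-1) = ψ (-1) * Om 0 := by
    unfold casP
    rw [Fin.sum_univ_succ, Finset.sum_eq_zero]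
    · rw [hM0]; simp
    · intro l _
      have : (-1 : ℤ) + ((l.succ : ℕ) : ℤ) = ((l : ℕ) : ℤ) := by simp
      rw [this, hz]; ring
  have hP0 : casP φ ψ 0 = ε * ψ (m + 1) * Om 0 := by
    unfold casP
    rw [Fin.sum_univ_castSucc, Finset.sum_eq_zero]
    · rw [hMl]; simp [hε]
    · intro l _
      have : (0 : ℤ) + ((l.castSucc : ℕ) : ℤ) = ((l : ℕ) : ℤ) := by simp
      rw [this, hz]; ring
  have hP1 : casP φ ψ 1 = ε * (ψ (m + 1 + 1) * Om 1 - ψ (m + 1) * La 1) := by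
    unfold casP
    rw [Fin.sum_univ_castSucc, Fin.sum_univ_castSucc, Finset.sum_eq_zero]
    · rw [hMl, hMp]
      simp only [Fin.val_last, Fin.val_castSucc, hε]
      push_cast
      rw [show (1 : ℤ) + m = m + 1 by ring, show (1 : ℤ) + (m + 1) = m + 1 + 1 by ring]
      ring
    · intro l _
      have : (1 : ℤ) + ((l.castSucc.castSucc : ℕ) : ℤ) = ((l.succ : ℕ) : ℤ) := by
        simp [add_comm]
      rw [this, hz]; ring
  have hPT : casP φ (fun t => A t * ψ (t - 1) + B t * ψ t + C t * ψ (t + 1)) 0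
      = A 0 * ψ (-1) * Om 1 + ε * B (m + 1) * ψ (m + 1) * Om 0
        + (ε * C (m + 1) * ψ (m + 1 + 1) * Om 0 - ε * C m * ψ (m + 1) * La 0) := by
    have hs : casP φ (fun t => A t * ψ (t - 1) + B t * ψ t + C t * ψ (t + 1)) 0
      = casP φ (fun t => A t * ψ (t - 1)) 0 + casP φ (fun t => B t * ψ t) 0
        + casP φ (fun t => C t * ψ (t + 1)) 0 := by
      unfold casP
      rw [← Finset.sum_add_distrib, ← Finset.sum_add_distrib]
      apply Finset.sum_congr rfl
      intro j _
      ring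
    rw [hs]
    congr 1
    · congr 1
      · unfold casP
        rw [Fin.sum_univ_succ, Finset.sum_eq_zero]
        · rw [hM0]; simp
        · intro l _
          have : (0 : ℤ) + ((l.succ : ℕ) : ℤ) - 1 = ((l : ℕ) : ℤ) := by simp
          beta_reduce; rw [this, hz]; ring
      · unfold casP
        rw [Fin.sum_univ_castSucc, Finset.sum_eq_zero]
        · rw [hMl]; simp only [Fin.val_last, hε, zero_add]; push_cast; ring
        · intro l _
          have : (0 : ℤ) + ((l.castSucc : ℕ) : ℤ) = ((l : ℕ) : ℤ) := by simp
          beta_reduce; rw [this, hz]; ring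
    · unfold casP
      rw [Fin.sum_univ_castSucc, Fin.sum_univ_castSucc, Finset.sum_eq_zero]
      · rw [hMl, hMp]
        simp only [Fin.val_last, Fin.val_castSucc, hε]
        push_cast
        rw [show (0 : ℤ) + m = m by ring, show (0 : ℤ) + (m + 1) = m + 1 by ring]
        ring
      · intro l _
        have : (0 : ℤ) + ((l.castSucc.castSucc : ℕ) : ℤ) + 1 = ((l.succ : ℕ) : ℤ) := by
          simp
        beta_reduce; rw [this, hz]; ring
  rw [hPT] at hT
  rw [hPψ] at hT
  rw [hPψ, hPψ, hPψ]
  rw [hPm, hP1]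
  linear_combination (-(Om 0 * Om 1)) * hT +
    (B (m + 1) * Om 0 * Om 1 + C (m + 1) * La 1 * Om 0 - C m * La 0 * Om 1) * hP0

/-- The rows, as functions of an integer shift. -/
noncomputable def rowF (a c : ℝ) (F1 F2 : Finset ℕ) (x : ℝ) (i : ℕ) (t : ℤ) : ℝ :=
  if i < F1.card then meixner a c (nth F1 i) (x + t)
  else a ^ (-t) * meixner a⁻¹ c (nth F2 (i - F1.card)) (x + t)

/-- Row scaling. -/
noncomputable def rowW (a : ℝ) (F1 : Finset ℕ) (i : ℕ) : ℝ := if i < F1.card then 1 else a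

lemma row_shift (a c : ℝ) (ha0 : a ≠ 0) (F1 F2 : Finset ℕ) (x : ℝ) (i : ℕ) (s : ℤ) (l : ℕ) :
    (if i < F1.card then meixner a c (nth F1 i) (x + s + (l : ℝ))
    else a ^ (-(l : ℤ)) * meixner a⁻¹ c (nth F2 (i - F1.card)) (x + s + (l : ℝ)))
    = rowW a F1 i ^ s * rowF a c F1 F2 x i (s + l) := by
  unfold rowW rowF
  split_ifs
  · rw [one_zpow, one_mul]; push_cast; rw [add_assoc]
  · rw [← mul_assoc, ← zpow_add₀ ha0]
    push_cast
    rw [add_assoc, show s + -(s + (l : ℤ)) = -(l : ℤ) by ring]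

lemma row_eq (a c : ℝ) (ha0 : a ≠ 0) (F1 F2 : Finset ℕ) (x : ℝ) (i : ℕ) (t : ℤ) :
    (x + t) * rowF a c F1 F2 x i (t - 1) + (-((1 + a) * (x + t) + a * c)) * rowF a c F1 F2 x i t
      + a * (x + t + c) * rowF a c F1 F2 x i (t + 1)
    = (if i < F1.card then (a - 1) * (nth F1 i) else (1 - a) * (nth F2 (i - F1.card) + c))
      * rowF a c F1 F2 x i t := by
  unfold rowF
  split_ifs
  · have := meixner_eq a c ha0 (nth F1 i) (x + t)
    push_cast
    rw [← add_sub_assoc, ← add_assoc]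
    linear_combination this
  · have := meixner_eq a⁻¹ c (inv_ne_zero ha0) (nth F2 (i - F1.card)) (x + t)
    push_cast
    rw [← add_sub_assoc, ← add_assoc]
    have e1 : a ^ (-(t - 1)) = a ^ (-t) * a := by
      rw [← zpow_add_one₀ ha0]; congr 1; ring
    have e2 : a ^ (-(t + 1)) = a ^ (-t) * a⁻¹ := by
      rw [← zpow_sub_one₀ ha0]; congr 1; ring
    rw [e1, e2]
    have hi : a * a⁻¹ = 1 := mul_inv_cancel₀ ha0
    generalize meixner a⁻¹ c (nth F2 (i - F1.card)) (x + t - 1) = p at *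
    generalize meixner a⁻¹ c (nth F2 (i - F1.card)) (x + t + 1) = q at *
    generalize meixner a⁻¹ c (nth F2 (i - F1.card)) (x + t) = r at *
    generalize a⁻¹ = b at *
    generalize a ^ (-t) = z at *
    linear_combination (a * z) * this +
      z * ((x + t + c) * r + (nth F2 (i - F1.card)) * r) * hi

theorem det_scale {k : ℕ} (w : Fin k → ℝ) (M N : Matrix (Fin k) (Fin k) ℝ)
    (h : ∀ i j, M i j = w i * N i j) : M.det = (∏ i, w i) * N.det := by
  rw [← Matrix.det_mul_column]
  congr 1
  ext i j
  simp [h]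

/-- Theorem 3.3: the polynomials `m_n^{a,c;𝓕}`, `n ∈ σ_𝓕`, are eigenfunctions of the second
order difference operator `D_𝓕` with eigenvalue `n` (at every point where the denominators
`Ω_𝓕^{a,c}(x)`, `Ω_𝓕^{a,c}(x+1)` do not vanish). -/
theorem meixner_exceptional_difference_eq (a c : ℝ) (ha0 : a ≠ 0) (ha1 : a ≠ 1)
    (hc : ∀ n : ℕ, c ≠ -(n : ℝ))
    (F1 F2 : Finset ℕ) (hF1 : ∀ f ∈ F1, 0 < f) (hF2 : ∀ f ∈ F2, 0 < f)
    (hne : F1.Nonempty ∨ F2.Nonempty)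
    (n : ℕ) (hn : n ∈ sigmaF F1 F2) (x : ℝ)
    (hΩx : OmegaM a c F1 F2 x ≠ 0) (hΩx1 : OmegaM a c F1 F2 (x + 1) ≠ 0) :
    DopM a c F1 F2 (fun t => mExc a c F1 F2 n t) x = (n : ℝ) * mExc a c F1 F2 n x := by
  obtain ⟨hn1, -⟩ := hn
  obtain ⟨m, hm⟩ : ∃ m, F1.card + F2.card = m + 1 := by
    rcases hne with h | h
    · have := h.card_pos
      exact ⟨F1.card + F2.card - 1, by omega⟩
    · have := h.card_pos
      exact ⟨F1.card + F2.card - 1, by omega⟩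
  set g : ℝ := ∏ i : Fin (m + 1), rowW a F1 i with hg
  have hg0 : g ≠ 0 := by
    rw [hg]
    apply Finset.prod_ne_zero_iff.2
    intro i _
    unfold rowW
    split_ifs
    · exact one_ne_zero
    · exact ha0
  set φ : Fin (m + 1) → ℤ → ℝ := fun i => rowF a c F1 F2 x i with hφ
  set f : ℤ → ℝ := fun t => meixner a c (n - uF F1 F2) (x + t) with hf
  set Om : ℤ → ℝ := fun s =>
    Matrix.det (Matrix.of fun i l : Fin (m + 1) => φ i (s + ((l : ℕ) : ℤ))) with hOm
  set La : ℤ → ℝ := fun s => Matrix.det (Matrix.of fun i l : Fin (m + 1) =>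
      φ i (s + ((if (l : ℕ) = m then m + 1 else (l : ℕ) : ℕ) : ℤ))) with hLa
  have gs : ∀ s : ℤ, ∏ i : Fin (m + 1), rowW a F1 i ^ s = g ^ s := by
    intro s
    rw [hg, Finset.prod_zpow]
  have kO : ∀ s : ℤ, OmegaM a c F1 F2 (x + s) = g ^ s * Om s := by
    intro s
    unfold OmegaM
    rw [hm, ← gs]
    apply det_scale
    intro i j
    exact row_shift a c ha0 F1 F2 x i s j
  have kL : ∀ s : ℤ, LambdaM a c F1 F2 (x + s) = g ^ s * La s := by
    intro s
    unfold LambdaM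
    rw [hm, ← gs]
    apply det_scale
    intro i j
    exact row_shift a c ha0 F1 F2 x i s _
  have kW : ∀ s : ℤ, mExc a c F1 F2 n (x + s) = g ^ s * casP φ f s := by
    intro s
    unfold mExc
    rw [hm, ← gs, casP_eq_det]
    have : ∏ i : Fin (m + 1), rowW a F1 i ^ s
        = ∏ i : Fin (m + 1 + 1), (Fin.cons 1 (fun i : Fin (m + 1) => rowW a F1 i ^ s) :
            Fin (m + 1 + 1) → ℝ) i := by
      conv_rhs => rw [Fin.prod_univ_succ]
      simp only [Fin.cons_zero, Fin.cons_succ, one_mul]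
    rw [this]
    apply det_scale
    intro i j
    refine Fin.cases ?_ (fun i => ?_) i
    · simp [hf, add_assoc]
    · have := row_shift a c ha0 F1 F2 x i s j
      simpa using this
  have main := casorati_darboux φ f (fun t => x + t) (fun t => -((1 + a) * (x + t) + a * c))
    (fun t => a * (x + t + c)) _ ((a - 1) * ((n - uF F1 F2 : ℕ) : ℝ))
    (fun i t => row_eq a c ha0 F1 F2 x i t)
    (fun t => by
      have := meixner_eq a c ha0 (n - uF F1 F2) (x + t)
      simp only [hf]
      push_cast
      rw [← add_sub_assoc, ← add_assoc]
      linear_combination this) Om La (fun _ => rfl) (fun _ => rfl)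
    (by
      have := kO 0
      simp only [Int.cast_zero, add_zero, zpow_zero, one_mul] at this
      rw [← this]; exact hΩx)
  have o0 := kO 0
  have o1 := kO 1
  have l0 := kL 0
  have l1 := kL 1
  have w0 := kW 0
  have w1 := kW 1
  have wm := kW (-1)
  simp only [Int.cast_zero, add_zero, zpow_zero, one_mul, Int.cast_one, zpow_one, Int.cast_neg,
    zpow_neg, ← sub_eq_add_neg] at o0 o1 l0 l1 w0 w1 wm
  rw [o0] at hΩx
  rw [o1] at hΩx1
  have hO1 : Om 1 ≠ 0 := right_ne_zero_of_mul hΩx1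
  have ha : a - 1 ≠ 0 := sub_ne_zero.2 ha1
  unfold DopM
  simp only []
  rw [o0, o1, l0, l1, w0, w1, wm, hm]
  rw [Nat.cast_sub hn1] at main
  push_cast at main ⊢
  generalize Om 0 = O0 at *
  generalize Om 1 = O1 at *
  generalize La 0 = L0 at *
  generalize La 1 = L1 at *
  generalize casP φ f 0 = W0 at *
  generalize casP φ f 1 = W1 at *
  generalize casP φ f (-1) = Wm at *
  rw [← sub_eq_zero]
  field_simp
  linear_combination main
end

section
/- Let a, c be real numbers with 0 < a < 1 and c ∉ {0,−1,−2,…}, and let 𝓕 = (F_1,F_2) be a pair of finite sets of positive integers, not both empty. The following are equivalent: (1) for every integer x ≥ u_𝓕, ∏_{f∈F_1}(x−f−u_𝓕)·∏_{f∈F_2}(x+c+f−u_𝓕)·Γ(x+c−u_𝓕) ≥ 0 (i.e., the discrete measure ρ_{a,c}^𝓕 is positive); (2) c and 𝓕 are admissible; (3) Γ(n+c+k)·Ω_𝓕^{a,c}(n)·Ω_𝓕^{a,c}(n+1) > 0 for every n ∈ ℕ. -/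
open Finset MeasureTheory Polynomial

/-! ### Part A: algebra of Meixner polynomials -/

lemma gb_desc (t : ℝ) (j : ℕ) : gbinom t j = (descPochhammer ℝ j).eval t / (Nat.factorial j) := by
  rw [gbinom, descPochhammer_eval_eq_prod_range]

lemma gb_eq (t : ℝ) (j : ℕ) : gbinom t j = Ring.choose t j := by
  rw [Ring.choose_eq_smul, gb_desc, smul_eq_mul, div_eq_inv_mul]
  congr 1
  rw [← Polynomial.eval₂_smulOneHom_eq_smeval, Polynomial.eval₂_eq_eval_map]
  simp [descPochhammer_map]

lemma gb_vand (s t : ℝ) (n : ℕ) :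
    gbinom (s + t) n = ∑ l ∈ range (n + 1), gbinom s l * gbinom t (n - l) := by
  simp only [gb_eq]
  rw [Ring.add_choose_eq n (Commute.all s t),
    Finset.Nat.sum_antidiagonal_eq_sum_range_succ (fun i j => Ring.choose s i * Ring.choose t j)]

lemma gb_nat (m j : ℕ) : gbinom (m : ℝ) j = (m.choose j : ℝ) := by
  rw [gb_eq, Ring.choose_natCast]

lemma gb_succ_left (t : ℝ) (j : ℕ) : ((j : ℝ) + 1) * gbinom t (j + 1) = t * gbinom (t - 1) j := by
  unfold gbinom
  rw [Finset.prod_range_succ', Nat.factorial_succ]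
  have h : ∀ i ∈ range j, t - ((i + 1 : ℕ) : ℝ) = t - 1 - i := by
    intro i _; push_cast; ring
  rw [Finset.prod_congr rfl h]
  have : ((Nat.factorial j : ℕ) : ℝ) ≠ 0 := by positivity
  have : (j : ℝ) + 1 ≠ 0 := by positivity
  push_cast
  field_simp
  ring

lemma gb_split (t : ℝ) (i l : ℕ) :
    gbinom t (i + l) * ((i + l).choose i : ℝ) = gbinom t i * gbinom (t - i) l := by
  unfold gbinom
  rw [Finset.prod_range_add, Nat.cast_choose ℝ (Nat.le_add_right i l)]
  have h : ∀ x ∈ range l, t - ((i + x : ℕ) : ℝ) = t - i - x := by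
    intro i _; push_cast; ring
  rw [Finset.prod_congr rfl h, Nat.add_sub_cancel_left]
  have h1 : ((Nat.factorial (i + l) : ℕ) : ℝ) ≠ 0 := by positivity
  field_simp

/-- The unnormalized Meixner sum. -/
noncomputable def mS (a c : ℝ) (n : ℕ) (x : ℝ) : ℝ :=
  ∑ j ∈ Finset.range (n + 1), a ^ (-(j : ℤ)) * gbinom x j * gbinom (-x - c) (n - j)

lemma meixner_mS (a c : ℝ) (n : ℕ) (x : ℝ) :
    meixner a c n x = (a / (1 - a)) ^ n * mS a c n x := rfl

lemma mS_backward (a c : ℝ) (ha : a ≠ 0) (n : ℕ) (x : ℝ) :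
    x / a * mS a (c + 1) n (x - 1) - (x + c) * mS a (c + 1) n x = (n + 1) * mS a c (n + 1) x := by
  have e1 : x / a * mS a (c + 1) n (x - 1) =
      ∑ j ∈ range (n + 1 + 1), (j : ℝ) * (a ^ (-(j : ℤ)) * gbinom x j * gbinom (-x - c) (n + 1 - j)) := by
    rw [Finset.sum_range_succ', mS, Finset.mul_sum]
    simp only [Nat.cast_zero, zero_mul, add_zero]
    refine Finset.sum_congr rfl fun j _ => ?_
    have h := gb_succ_left x j
    have h2 : n + 1 - (j + 1) = n - j := by omega
    have h3 : a ^ (-((j + 1 : ℕ) : ℤ)) = a ^ (-(j : ℤ)) / a := by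
      rw [Nat.cast_succ, neg_add, zpow_add₀ ha, zpow_neg_one, div_eq_mul_inv]
    have h4 : -(x - 1) - (c + 1) = -x - c := by ring
    rw [h2, h3, h4]
    push_cast
    calc _ = a ^ (-(j : ℤ)) / a * gbinom (-x - c) (n - j) * (x * gbinom (x - 1) j) := by ring
      _ = _ := by rw [← h]; ring
  have e2 : -((x + c) * mS a (c + 1) n x) =
      ∑ j ∈ range (n + 1 + 1), ((n + 1 - j : ℕ) : ℝ) *
        (a ^ (-(j : ℤ)) * gbinom x j * gbinom (-x - c) (n + 1 - j)) := by
    rw [Finset.sum_range_succ, mS, Finset.mul_sum, ← Finset.sum_neg_distrib]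
    simp only [Nat.sub_self, Nat.cast_zero, zero_mul, add_zero]
    refine Finset.sum_congr rfl fun j hj => ?_
    have hj' : j ≤ n := by simpa [Nat.lt_succ_iff] using hj
    have h := gb_succ_left (-x - c) (n - j)
    have h2 : n + 1 - j = n - j + 1 := by omega
    have h4 : -x - (c + 1) = -x - c - 1 := by ring
    rw [h2, h4]
    push_cast [hj'] at h ⊢
    calc _ = a ^ (-(j : ℤ)) * gbinom x j * ((-x - c) * gbinom (-x - c - 1) (n - j)) := by ring
      _ = _ := by rw [← h]; ring
  rw [sub_eq_add_neg, e1, e2, ← Finset.sum_add_distrib, mS, Finset.mul_sum]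
  refine Finset.sum_congr rfl fun j hj => ?_
  have hj' : j ≤ n + 1 := by simpa [Nat.lt_succ_iff] using hj
  push_cast [hj']
  ring

lemma mS_hyp (a c : ℝ) (n : ℕ) (x : ℝ) :
    mS a c n x = ∑ i ∈ range (n + 1), (a⁻¹ - 1) ^ i * gbinom x i * gbinom (-c - i) (n - i) := by
  have e1 : mS a c n x = ∑ j ∈ Ico 0 (n + 1), ∑ i ∈ Ico 0 (j + 1),
      (a⁻¹ - 1) ^ i * (j.choose i : ℝ) * gbinom x j * gbinom (-x - c) (n - j) := by
    rw [mS, Finset.range_eq_Ico]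
    refine Finset.sum_congr rfl fun j hj => ?_
    have : a ^ (-(j : ℤ)) = ∑ i ∈ Ico 0 (j + 1), (a⁻¹ - 1) ^ i * (j.choose i : ℝ) := by
      rw [zpow_neg, zpow_natCast, ← inv_pow]
      conv_lhs => rw [show a⁻¹ = (a⁻¹ - 1) + 1 by ring, add_pow]
      simp
    rw [this, Finset.sum_mul, Finset.sum_mul]
  rw [e1, ← Finset.sum_Ico_Ico_comm, Finset.range_eq_Ico]
  refine Finset.sum_congr rfl fun i hi => ?_
  have hi' : i ≤ n := by simpa [Nat.lt_succ_iff] using hi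
  rw [Finset.sum_Ico_eq_sum_range, show -c - (i : ℝ) = (x - i) + (-x - c) by ring, gb_vand,
    Finset.mul_sum, show n + 1 - i = n - i + 1 by omega]
  refine Finset.sum_congr rfl fun l hl => ?_
  have := gb_split x i l
  rw [show n - (i + l) = n - i - l by omega]
  calc _ = (a⁻¹ - 1) ^ i * (gbinom x (i + l) * ((i + l).choose i : ℝ)) * gbinom (-x - c) (n - i - l) := by ring
    _ = _ := by rw [this]; ring

/-- The Meixner polynomial as a polynomial. -/
noncomputable def mP (a c : ℝ) (n : ℕ) : ℝ[X] :=
  ∑ i ∈ range (n + 1), C ((a / (1 - a)) ^ n * ((a⁻¹ - 1) ^ i * gbinom (-c - i) (n - i)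
    / (Nat.factorial i))) * descPochhammer ℝ i

lemma mP_eval (a c : ℝ) (n : ℕ) (x : ℝ) : (mP a c n).eval x = meixner a c n x := by
  rw [meixner_mS, mS_hyp, mP, Polynomial.eval_finsetSum, Finset.mul_sum]
  refine Finset.sum_congr rfl fun i hi => ?_
  rw [Polynomial.eval_mul, Polynomial.eval_C, gb_desc x i]
  ring

lemma mP_natDegree_le (a c : ℝ) (n : ℕ) : (mP a c n).natDegree ≤ n := by
  refine Polynomial.natDegree_sum_le_of_forall_le _ _ fun i hi => ?_
  refine (Polynomial.natDegree_C_mul_le _ _).trans ?_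
  rw [descPochhammer_natDegree]
  simpa [Nat.lt_succ_iff] using hi

lemma mP_coeff (a c : ℝ) (ha0 : 0 < a) (ha1 : a < 1) (n : ℕ) :
    (mP a c n).coeff n = 1 / (Nat.factorial n) := by
  rw [mP, Polynomial.finsetSum_coeff, Finset.sum_range_succ, Finset.sum_eq_zero, zero_add,
    Polynomial.coeff_C_mul]
  · have h := (monic_descPochhammer ℝ n).coeff_natDegree
    rw [descPochhammer_natDegree] at h
    have h1 : (1 - a) ≠ 0 := by linarith
    have h2 : a / (1 - a) * (a⁻¹ - 1) = 1 := by
      field_simp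
    rw [h, Nat.sub_self, show gbinom (-c - n) 0 = 1 by simp [gbinom], mul_one, mul_one,
      ← mul_div_assoc, ← mul_pow, h2, one_pow]
  · intro i hi
    rw [Polynomial.coeff_C_mul, Polynomial.coeff_eq_zero_of_natDegree_lt, mul_zero]
    rw [descPochhammer_natDegree]
    simpa using hi

/-- The symmetric kernel of the duality. -/
noncomputable def mK (a c : ℝ) (n f : ℕ) : ℝ :=
  ∑ i ∈ range (n + f + 1), (1 - a⁻¹) ^ i * (f.choose i : ℝ) * (n.choose i : ℝ) * (Nat.factorial i)
    / poch c i

lemma mK_symm (a c : ℝ) (n f : ℕ) : mK a c n f = mK a c f n := by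
  rw [mK, mK, add_comm n f]
  exact Finset.sum_congr rfl fun i _ => by ring

lemma poch_ne (c : ℝ) (hc : ∀ n : ℕ, c ≠ -(n : ℝ)) (n : ℕ) : poch c n ≠ 0 := by
  rw [poch, Finset.prod_ne_zero_iff]
  intro i _ h
  exact hc i (by linarith)

lemma gb_poch (c : ℝ) (i l : ℕ) :
    gbinom (-c - i) l * poch c i * (Nat.factorial l) = (-1) ^ l * poch c (i + l) := by
  have : ((Nat.factorial l : ℕ) : ℝ) ≠ 0 := by positivity
  rw [gbinom, poch, poch, Finset.prod_range_add]
  have h : ∀ x ∈ range l, -c - (i : ℝ) - x = (-1) * (c + ((i + x : ℕ) : ℝ)) := by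
    intro i _; push_cast; ring
  rw [Finset.prod_congr rfl h, Finset.prod_mul_distrib, Finset.prod_const, Finset.card_range]
  field_simp

lemma mS_dual (a c : ℝ) (hc : ∀ n : ℕ, c ≠ -(n : ℝ)) (n f : ℕ) :
    mS a c n f = (-1) ^ n * poch c n / (Nat.factorial n) * mK a c n f := by
  have e : mK a c n f = ∑ i ∈ range (n + 1), (1 - a⁻¹) ^ i * (f.choose i : ℝ) * (n.choose i : ℝ)
      * (Nat.factorial i) / poch c i := by
    rw [mK]
    symm
    refine Finset.sum_subset (Finset.range_subset_range.2 (by omega)) fun i _ hi => ?_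
    rw [Nat.choose_eq_zero_of_lt (n := n) (by simpa [Nat.lt_succ_iff] using hi)]
    simp
  rw [mS_hyp, e, Finset.mul_sum]
  refine Finset.sum_congr rfl fun i hi => ?_
  have hi' : i ≤ n := by simpa [Nat.lt_succ_iff] using hi
  obtain ⟨l, rfl⟩ := Nat.exists_eq_add_of_le hi'
  have h1 := poch_ne c hc i
  have h2 : ((Nat.factorial l : ℕ) : ℝ) ≠ 0 := by positivity
  have h3 : ((Nat.factorial i : ℕ) : ℝ) ≠ 0 := by positivity
  have h4 : ((Nat.factorial (i + l) : ℕ) : ℝ) ≠ 0 := by positivity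
  have h5 : gbinom (-c - i) l = (-1) ^ l * poch c (i + l) / (poch c i * (Nat.factorial l)) := by
    rw [eq_div_iff (by positivity), ← gb_poch]; ring
  have h6 : (1 - a⁻¹) ^ i = (-1) ^ i * (a⁻¹ - 1) ^ i := by
    rw [← mul_pow]; congr 1; ring
  rw [Nat.add_sub_cancel_left, h5, gb_nat, h6, Nat.cast_choose ℝ (Nat.le_add_right i l),
    Nat.add_sub_cancel_left, pow_add]
  have h7 : (-1 : ℝ) ^ i * (-1) ^ i = 1 := by rw [← mul_pow]; simp
  field_simp
  linear_combination (-(poch c (i + l) * (a⁻¹ - 1) ^ i * (f.choose i))) * h7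

/-- The duality factor. -/
noncomputable def cf (a c : ℝ) (n : ℕ) : ℝ := (a / (a - 1)) ^ n * poch c n / (Nat.factorial n)

lemma meixner_cf (a c : ℝ) (hc : ∀ n : ℕ, c ≠ -(n : ℝ)) (n f : ℕ) :
    meixner a c n f = cf a c n * mK a c n f := by
  rw [meixner_mS, mS_dual a c hc, cf]
  have : (a / (a - 1)) = (-1) * (a / (1 - a)) := by
    rw [← neg_sub 1 a, div_neg]; ring
  rw [this, mul_pow]; ring

lemma dual1 (a c : ℝ) (hc : ∀ n : ℕ, c ≠ -(n : ℝ)) (n f : ℕ) :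
    meixner a c n f * cf a c f = cf a c n * meixner a c f n := by
  rw [meixner_cf a c hc, meixner_cf a c hc, mK_symm a c n f]; ring

lemma meixner_refl (a c : ℝ) (ha0 : 0 < a) (ha1 : a < 1) (n : ℕ) (x : ℝ) :
    meixner a c n (-c - x) = (-1) ^ n * meixner a⁻¹ c n x := by
  have ha : (1 - a) ≠ 0 := by linarith
  have e : mS a c n (-c - x) = (a⁻¹) ^ n * mS a⁻¹ c n x := by
    rw [mS, mS, ← Finset.sum_range_reflect, Finset.mul_sum]
    refine Finset.sum_congr rfl fun j hj => ?_
    have hj' : j ≤ n := by simpa [Nat.lt_succ_iff] using hj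
    rw [show n + 1 - 1 - j = n - j by omega, show n - (n - j) = j by omega,
      show -(-c - x) - c = x by ring, show -c - x = -x - c by ring]
    have : a ^ (-((n - j : ℕ) : ℤ)) = a⁻¹ ^ n * a⁻¹ ^ (-(j : ℤ)) := by
      rw [Nat.cast_sub hj', inv_zpow, ← zpow_neg, inv_pow, ← zpow_natCast a n, ← zpow_neg,
        ← zpow_add₀ ha0.ne']
      congr 1; ring
    rw [this]; ring
  rw [meixner_mS, meixner_mS, e, ← mul_assoc, ← mul_assoc, ← mul_pow, ← mul_pow]
  congr 2
  have : a - 1 ≠ 0 := by linarith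
  have h3 : 1 - a⁻¹ = (a - 1) / a := by field_simp
  rw [h3]
  field_simp
  ring

lemma cf_inv (a c : ℝ) (ha0 : 0 < a) (ha1 : a < 1) (n : ℕ) :
    (-1) ^ n * cf a⁻¹ c n = cf a c n * a⁻¹ ^ n := by
  have ha : (a - 1) ≠ 0 := by linarith
  have ha2 : (1 - a) ≠ 0 := by linarith
  have h : -1 * (a⁻¹ / (a⁻¹ - 1)) = a / (a - 1) * a⁻¹ := by
    have h3 : a⁻¹ - 1 = (1 - a) / a := by field_simp
    rw [h3]
    field_simp
    ring
  rw [cf, cf]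
  calc _ = (-1 * (a⁻¹ / (a⁻¹ - 1))) ^ n * poch c n / (Nat.factorial n) := by rw [mul_pow]; ring
    _ = _ := by rw [h, mul_pow]; ring

lemma dual2 (a c : ℝ) (ha0 : 0 < a) (ha1 : a < 1) (hc : ∀ n : ℕ, c ≠ -(n : ℝ)) (n f : ℕ) :
    meixner a c n (-c - f) * cf a⁻¹ c f = cf a c n * (a⁻¹ ^ n * meixner a⁻¹ c f n) := by
  rw [meixner_refl a c ha0 ha1, mul_assoc, dual1 a⁻¹ c hc, ← mul_assoc, cf_inv a c ha0 ha1]; ring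


/-! ### Part B: the Meixner functional -/

/-- The Meixner weight. -/
noncomputable def wt (a c : ℝ) (x : ℕ) : ℝ := a ^ x * Real.Gamma (x + c) / (Nat.factorial x)

lemma hc_shift {c : ℝ} (hc : ∀ n : ℕ, c ≠ -(n : ℝ)) (m : ℕ) : ∀ n : ℕ, c + m ≠ -(n : ℝ) := by
  intro n h
  apply hc (n + m)
  push_cast
  linarith

lemma hc_nat {c : ℝ} (hc : ∀ n : ℕ, c ≠ -(n : ℝ)) (m : ℕ) : (m : ℝ) + c ≠ 0 := by
  intro h
  exact hc m (by linarith)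

lemma gamma_ne {c : ℝ} (hc : ∀ n : ℕ, c ≠ -(n : ℝ)) (m : ℕ) : Real.Gamma ((m : ℝ) + c) ≠ 0 := by
  apply Real.Gamma_ne_zero
  intro n
  rw [add_comm]
  exact hc_shift hc m n

lemma wt_ne {a c : ℝ} (ha0 : 0 < a) (hc : ∀ n : ℕ, c ≠ -(n : ℝ)) (x : ℕ) : wt a c x ≠ 0 := by
  have := gamma_ne hc x
  rw [wt]
  positivity

lemma wt_succ {a c : ℝ} (hc : ∀ n : ℕ, c ≠ -(n : ℝ)) (x : ℕ) :
    ((x : ℝ) + 1) * wt a c (x + 1) = a * ((x : ℝ) + c) * wt a c x := by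
  rw [wt, wt, Nat.factorial_succ, pow_succ]
  have h := Real.Gamma_add_one (hc_nat hc x)
  rw [show ((x + 1 : ℕ) : ℝ) + c = (x : ℝ) + c + 1 by push_cast; ring, h]
  push_cast
  have : (x : ℝ) + 1 ≠ 0 := by positivity
  field_simp

lemma wt_add_one {a c : ℝ} (hc : ∀ n : ℕ, c ≠ -(n : ℝ)) (x : ℕ) :
    wt a (c + 1) x = ((x : ℝ) + c) * wt a c x := by
  rw [wt, wt]
  have h := Real.Gamma_add_one (hc_nat hc x)
  rw [show (x : ℝ) + (c + 1) = (x : ℝ) + c + 1 by ring, h]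
  ring

lemma wt_summable_pow {a c : ℝ} (ha0 : 0 < a) (ha1 : a < 1) (hc : ∀ n : ℕ, c ≠ -(n : ℝ)) (k : ℕ) :
    Summable fun x : ℕ => (x : ℝ) ^ k * wt a c x := by
  refine summable_of_ratio_test_tendsto_lt_one ha1 ?_ ?_
  · filter_upwards [Filter.eventually_gt_atTop 0] with x hx
    have := wt_ne ha0 hc x
    positivity
  · have hinv : Filter.Tendsto (fun x : ℕ => ((x : ℝ))⁻¹) Filter.atTop (nhds 0) :=
      tendsto_inv_atTop_zero.comp tendsto_natCast_atTop_atTop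
    have h1 : Filter.Tendsto (fun x : ℕ => (1 + ((x : ℝ))⁻¹) ^ k *
        (a * ((1 + c * (x : ℝ)⁻¹) / (1 + (x : ℝ)⁻¹)))) Filter.atTop
        (nhds ((1 + 0) ^ k * (a * ((1 + c * 0) / (1 + 0))))) := by
      refine Filter.Tendsto.mul ((hinv.const_add 1).pow k) (Filter.Tendsto.const_mul a ?_)
      exact Filter.Tendsto.div ((hinv.const_mul c).const_add 1) (hinv.const_add 1) (by norm_num)
    have h2 := h1.abs
    have e : |((1 + 0 : ℝ) ^ k * (a * ((1 + c * 0) / (1 + 0))))| = a := by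
      simp [abs_of_pos ha0]
    rw [e] at h2
    refine h2.congr' ?_
    filter_upwards [Filter.eventually_gt_atTop 0] with x hx
    have hw := wt_ne ha0 hc x
    have hx' : (x : ℝ) ≠ 0 := by positivity
    have hx1 : (x : ℝ) + 1 ≠ 0 := by positivity
    rw [← norm_div, Real.norm_eq_abs]
    congr 1
    have hs := wt_succ (a := a) hc x
    have hs' : wt a c (x + 1) = a * ((x : ℝ) + c) * wt a c x / ((x : ℝ) + 1) := by
      rw [eq_div_iff hx1, ← hs]; ring
    rw [hs']
    push_cast
    have e1 : 1 + (x : ℝ)⁻¹ = (x + 1) / x := by field_simp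
    have e2 : 1 + c * (x : ℝ)⁻¹ = (x + c) / x := by field_simp
    rw [e1, e2, div_pow]
    field_simp

lemma wt_summable {a c : ℝ} (ha0 : 0 < a) (ha1 : a < 1) (hc : ∀ n : ℕ, c ≠ -(n : ℝ)) (p : ℝ[X]) :
    Summable fun x : ℕ => p.eval (x : ℝ) * wt a c x := by
  induction p using Polynomial.induction_on' with
  | add p q hp hq => simpa [add_mul] using hp.add hq
  | monomial n r =>
    simpa [Polynomial.eval_monomial, mul_assoc] using (wt_summable_pow ha0 ha1 hc n).mul_left r

lemma wt_bound {a c : ℝ} (ha0 : 0 < a) (ha1 : a < 1) (hc : ∀ n : ℕ, c ≠ -(n : ℝ)) (p : ℝ[X]) :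
    ∃ K ρ : ℝ, 0 < ρ ∧ ρ < 1 ∧ ∀ x : ℕ, |p.eval (x : ℝ) * wt a c x| ≤ K * ρ ^ x := by
  obtain ⟨ρ, h1, h2⟩ := exists_between ha1
  have hρ0 : 0 < ρ := ha0.trans h1
  have hs := (wt_summable (a := a / ρ) (by positivity) ((div_lt_one hρ0).2 h1) hc p)
  obtain ⟨K, hK⟩ := hs.tendsto_atTop_zero.abs.bddAbove_range
  refine ⟨K, ρ, hρ0, h2, fun x => ?_⟩
  have h3 : |p.eval (x : ℝ) * wt (a / ρ) c x| ≤ K := hK ⟨x, rfl⟩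
  have h4 : wt a c x = wt (a / ρ) c x * ρ ^ x := by
    rw [wt, wt, div_pow]
    field_simp
  rw [h4, ← mul_assoc, abs_mul, abs_of_pos (pow_pos hρ0 x)]
  gcongr

/-- The Meixner functional. -/
noncomputable def Lf (a c : ℝ) (p : ℝ[X]) : ℝ := ∑' x : ℕ, p.eval (x : ℝ) * wt a c x

lemma Lf_add {a c : ℝ} (ha0 : 0 < a) (ha1 : a < 1) (hc : ∀ n : ℕ, c ≠ -(n : ℝ)) (p q : ℝ[X]) : Lf a c (p + q) = Lf a c p + Lf a c q := by
  rw [Lf, Lf, Lf, ← (wt_summable ha0 ha1 hc p).tsum_add (wt_summable ha0 ha1 hc q)]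
  exact tsum_congr fun x => by rw [Polynomial.eval_add]; ring

lemma Lf_C_mul (a c : ℝ) (r : ℝ) (p : ℝ[X]) : Lf a c (C r * p) = r * Lf a c p := by
  rw [Lf, Lf, ← tsum_mul_left]
  exact tsum_congr fun x => by rw [Polynomial.eval_mul, Polynomial.eval_C]; ring

lemma Lf_sub {a c : ℝ} (ha0 : 0 < a) (ha1 : a < 1) (hc : ∀ n : ℕ, c ≠ -(n : ℝ)) (p q : ℝ[X]) :
    Lf a c (p - q) = Lf a c p - Lf a c q := by
  have : p - q = p + C (-1) * q := by simp [sub_eq_add_neg]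
  rw [this, Lf_add ha0 ha1 hc, Lf_C_mul]; ring

lemma Lf_sum {a c : ℝ} (ha0 : 0 < a) (ha1 : a < 1) (hc : ∀ n : ℕ, c ≠ -(n : ℝ)) {ι : Type*}
    (s : Finset ι) (f : ι → ℝ[X]) : Lf a c (∑ i ∈ s, f i) = ∑ i ∈ s, Lf a c (f i) := by
  classical
  induction s using Finset.induction_on with
  | empty => simp [Lf]
  | insert i s hi ih => rw [Finset.sum_insert hi, Finset.sum_insert hi, Lf_add ha0 ha1 hc, ih]

lemma Lf_pearson {a c : ℝ} (ha0 : 0 < a) (ha1 : a < 1) (hc : ∀ n : ℕ, c ≠ -(n : ℝ)) (p : ℝ[X]) :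
    Lf a c (X * p) = a * Lf a c ((X + C c) * p.comp (X + 1)) := by
  rw [Lf, (wt_summable ha0 ha1 hc _).tsum_eq_zero_add, Lf, ← tsum_mul_left]
  simp only [Nat.cast_zero, Polynomial.eval_mul, Polynomial.eval_X, zero_mul, zero_add]
  refine tsum_congr fun x => ?_
  have hs := wt_succ (a := a) hc x
  simp only [Polynomial.eval_add, Polynomial.eval_comp, Polynomial.eval_X, Polynomial.eval_C,
    Polynomial.eval_one]
  push_cast
  linear_combination (p.eval ((x : ℝ) + 1)) * hs

lemma Lf_add_one {a c : ℝ} (hc : ∀ n : ℕ, c ≠ -(n : ℝ)) (p : ℝ[X]) :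
    Lf a (c + 1) p = Lf a c ((X + C c) * p) := by
  rw [Lf, Lf]
  refine tsum_congr fun x => ?_
  rw [wt_add_one hc]
  simp only [Polynomial.eval_mul, Polynomial.eval_add, Polynomial.eval_X, Polynomial.eval_C]
  ring

/-- Forward difference of a polynomial. -/
noncomputable def pD (p : ℝ[X]) : ℝ[X] := p.comp (X + 1) - p

lemma Lf_back {a c : ℝ} (ha0 : 0 < a) (ha1 : a < 1) (hc : ∀ n : ℕ, c ≠ -(n : ℝ)) (n : ℕ)
    (p : ℝ[X]) :
    Lf a c (mP a c (n + 1) * p) = a / (1 - a) / (n + 1) * Lf a (c + 1) (mP a (c + 1) n * pD p) := by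
  set r := mP a (c + 1) n with hr
  have ha : 1 - a ≠ 0 := by linarith
  have hn : (n : ℝ) + 1 ≠ 0 := by positivity
  have h1 := Lf_pearson ha0 ha1 hc (r.comp (X - 1) * p)
  have hcomp : (r.comp (X - 1) * p).comp (X + 1) = r * p.comp (X + 1) := by
    rw [Polynomial.mul_comp, Polynomial.comp_assoc]
    simp
  rw [hcomp] at h1
  have hid : mP a c (n + 1) * p = C (a / (1 - a) / (n + 1)) *
      (C a⁻¹ * (X * (r.comp (X - 1) * p)) - (X + C c) * (r * p)) := by
    apply Polynomial.funext
    intro x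
    simp only [Polynomial.eval_mul, Polynomial.eval_sub, Polynomial.eval_add, Polynomial.eval_X,
      Polynomial.eval_C, Polynomial.eval_comp, Polynomial.eval_one, hr, mP_eval, meixner_mS]
    have hb := mS_backward a c ha0.ne' n x
    have hb' : mS a c (n + 1) x = (x / a * mS a (c + 1) n (x - 1) - (x + c) * mS a (c + 1) n x)
        / (n + 1) := by
      rw [eq_div_iff hn, hb]; ring
    rw [hb', pow_succ]
    field_simp
  have e : (X + C c) * (r * pD p) = (X + C c) * (r * p.comp (X + 1)) - (X + C c) * (r * p) := by
    rw [pD]; ring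
  rw [Lf_add_one hc, e, Lf_sub ha0 ha1 hc, hid, Lf_C_mul, Lf_sub ha0 ha1 hc, Lf_C_mul, h1,
    inv_mul_cancel_left₀ ha0.ne']

lemma Lf_iter {a : ℝ} (ha0 : 0 < a) (ha1 : a < 1) (n : ℕ) : ∀ (c : ℝ)
    (_ : ∀ n : ℕ, c ≠ -(n : ℝ)) (p : ℝ[X]),
    Lf a c (mP a c n * p) = (a / (1 - a)) ^ n / (Nat.factorial n) * Lf a (c + n) (pD^[n] p) := by
  induction n with
  | zero =>
    intro c hc p
    have : mP a c 0 = 1 := by simp [mP, gbinom]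
    simp [this]
  | succ n ih =>
    intro c hc p
    have hc1 : ∀ m : ℕ, c + 1 ≠ -(m : ℝ) := by simpa using hc_shift hc 1
    rw [Lf_back ha0 ha1 hc, ih (c + 1) hc1, Nat.factorial_succ, Function.iterate_succ_apply,
      show c + ((n + 1 : ℕ) : ℝ) = c + 1 + n by push_cast; ring]
    push_cast
    have hn : (n : ℝ) + 1 ≠ 0 := by positivity
    field_simp
    ring

lemma pD_iter_eval (n : ℕ) (p : ℝ[X]) (x : ℝ) :
    (pD^[n] p).eval x = (fwdDiff (1 : ℝ))^[n] p.eval x := by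
  induction n generalizing x p with
  | zero => rfl
  | succ n ih =>
    have h : (fun y => (pD p).eval y) = fwdDiff (1 : ℝ) (fun y => p.eval y) := by
      funext y
      simp [pD, fwdDiff]
    rw [Function.iterate_succ_apply, Function.iterate_succ_apply, ih]
    exact congrArg (fun g => (fwdDiff (1 : ℝ))^[n] g x) h

lemma pD_iter (n : ℕ) (p : ℝ[X]) (hp : p.natDegree ≤ n) :
    pD^[n] p = C ((Nat.factorial n) * p.coeff n) := by
  apply Polynomial.funext
  intro x
  rw [pD_iter_eval, Polynomial.eval_C]
  rcases hp.lt_or_eq with h | h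
  · rw [Polynomial.fwdDiff_iter_eq_zero_of_degree_lt h, Polynomial.coeff_eq_zero_of_natDegree_lt h]
    simp
  · subst h
    rw [Polynomial.fwdDiff_iter_degree_eq_factorial]
    simp [mul_comm]

lemma Lf_ortho {a c : ℝ} (ha0 : 0 < a) (ha1 : a < 1) (hc : ∀ n : ℕ, c ≠ -(n : ℝ)) (n : ℕ)
    (p : ℝ[X]) (hp : p.natDegree ≤ n) :
    Lf a c (mP a c n * p) = (a / (1 - a)) ^ n * p.coeff n * Lf a (c + n) 1 := by
  rw [Lf_iter ha0 ha1 n c hc, pD_iter n p hp, ← mul_one (C _), Lf_C_mul]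
  have : ((Nat.factorial n : ℕ) : ℝ) ≠ 0 := by positivity
  field_simp

lemma Lf_one_pos {a c : ℝ} (ha0 : 0 < a) (ha1 : a < 1) (hc : ∀ n : ℕ, c ≠ -(n : ℝ)) :
    0 < Real.Gamma c * Lf a c 1 := by
  have key : ∀ (N : ℕ) (c : ℝ), (∀ n : ℕ, c ≠ -(n : ℝ)) → 0 < c + N →
      0 < Real.Gamma c * Lf a c 1 := by
    intro N
    induction N with
    | zero =>
      intro c hc hpos
      simp only [Nat.cast_zero, add_zero] at hpos
      have hw : ∀ x, 0 < wt a c x := by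
        intro x
        have : 0 < Real.Gamma (x + c) := Real.Gamma_pos_of_pos (by positivity)
        rw [wt]; positivity
      refine mul_pos (Real.Gamma_pos_of_pos hpos) ?_
      refine (wt_summable ha0 ha1 hc 1).tsum_pos (fun x => ?_) 0 ?_
      · simpa using (hw x).le
      · simpa using hw 0
    | succ N ih =>
      intro c hc hpos
      have hc1 : ∀ m : ℕ, c + 1 ≠ -(m : ℝ) := by simpa using hc_shift hc 1
      have h := ih (c + 1) hc1 (by push_cast at hpos; linarith)
      have hc0 : c ≠ 0 := by simpa using hc 0
      have h1 := Lf_pearson ha0 ha1 hc 1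
      have h2 := Lf_add_one (a := a) hc 1
      have h3 := Lf_add ha0 ha1 hc X (C c)
      have h4 := Lf_C_mul a c c 1
      simp only [mul_one, Polynomial.one_comp] at h1 h2 h4
      have ha : 0 < 1 - a := by linarith
      have h5 : (1 - a) * Lf a (c + 1) 1 = c * Lf a c 1 := by
        rw [h2]
        rw [h3] at h1 ⊢
        linear_combination h1 + h4
      rw [Real.Gamma_add_one hc0] at h
      have h6 : 0 < c ^ 2 * (Real.Gamma c * Lf a c 1) := by
        have := mul_pos ha h
        calc 0 < _ := this
          _ = _ := by linear_combination (c * Real.Gamma c) * h5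
      exact pos_of_mul_pos_right h6 (sq_nonneg c)
  obtain ⟨N, hN⟩ := exists_nat_gt (-c)
  exact key N c hc (by linarith)


/-! ### Part C: density of polynomials -/

lemma moment_zero (u : ℕ → ℝ) (K ρ : ℝ) (hρ0 : 0 < ρ) (hρ1 : ρ < 1)
    (hu : ∀ x, |u x| ≤ K * ρ ^ x) (hm : ∀ k : ℕ, ∑' x : ℕ, (x : ℝ) ^ k * u x = 0) (x : ℕ) :
    u x = 0 := by
  set P := FormalMultilinearSeries.ofScalars ℝ u with hP
  have hlog : Real.log ρ < 0 := Real.log_neg hρ0 hρ1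
  have hrad : ((Real.toNNReal ρ⁻¹ : NNReal) : ENNReal) ≤ P.radius := by
    refine P.le_radius_of_bound K fun n => ?_
    rw [hP, FormalMultilinearSeries.ofScalars_norm, Real.coe_toNNReal _ (inv_pos.2 hρ0).le]
    have h1 : (ρ ^ n) * (ρ⁻¹) ^ n = 1 := by
      rw [← mul_pow, mul_inv_cancel₀ hρ0.ne', one_pow]
    calc ‖u n‖ * (ρ⁻¹) ^ n ≤ K * ρ ^ n * (ρ⁻¹) ^ n := by
          gcongr; exact hu n
      _ = K := by rw [mul_assoc, h1, mul_one]
  have hpos : 0 < P.radius := lt_of_lt_of_le (by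
    rw [ENNReal.coe_pos, Real.toNNReal_pos]; exact inv_pos.2 hρ0) hrad
  have hfp := P.hasFPowerSeriesOnBall hpos
  have hsum : ∀ z, P.sum z = ∑' n, u n * z ^ n := by
    intro z
    rw [FormalMultilinearSeries.sum]
    refine tsum_congr fun n => ?_
    rw [hP, FormalMultilinearSeries.ofScalars_apply_eq, smul_eq_mul]
  have hz : ∀ t : ℝ, |t| < - Real.log ρ → P.sum (Real.exp t) = 0 := by
    intro t ht
    rw [hsum]
    have hq : ρ * Real.exp |t| < 1 := by
      rw [← Real.exp_log hρ0, ← Real.exp_add, Real.exp_lt_one_iff]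
      linarith
    have hexp : ∀ n : ℕ, HasSum (fun k : ℕ => u n * ((t * n) ^ k / (Nat.factorial k)))
        (u n * Real.exp t ^ n) := by
      intro n
      rw [← Real.exp_nat_mul, mul_comm (n : ℝ) t, Real.exp_eq_exp_ℝ]
      exact (NormedSpace.expSeries_div_hasSum_exp (𝔸 := ℝ) (t * n)).mul_left _
    have habs : ∀ n : ℕ, HasSum (fun k : ℕ => ‖u n * ((t * n) ^ k / (Nat.factorial k))‖)
        (|u n| * Real.exp |t| ^ n) := by
      intro n
      rw [← Real.exp_nat_mul, mul_comm (n : ℝ) |t|, Real.exp_eq_exp_ℝ]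
      have := (NormedSpace.expSeries_div_hasSum_exp (𝔸 := ℝ) (|t| * n)).mul_left |u n|
      have e : (fun k : ℕ => ‖u n * ((t * n) ^ k / (Nat.factorial k))‖) =
          fun k : ℕ => |u n| * ((|t| * n) ^ k / (Nat.factorial k)) := by
        funext k
        rw [Real.norm_eq_abs, abs_mul, abs_div, abs_pow, abs_mul, Nat.abs_cast, Nat.abs_cast]
      rw [e]
      exact this
    have hs : Summable (Function.uncurry fun (n k : ℕ) => u n * ((t * n) ^ k / (Nat.factorial k))) := by
      rw [← summable_norm_iff, summable_prod_of_nonneg (fun _ => norm_nonneg _)]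
      refine ⟨fun n => (habs n).summable, ?_⟩
      have : (fun n => ∑' k, ‖Function.uncurry (fun (n k : ℕ) => u n * ((t * n) ^ k / (Nat.factorial k))) (n, k)‖)
          = fun n => |u n| * Real.exp |t| ^ n := funext fun n => (habs n).tsum_eq
      rw [this]
      refine Summable.of_nonneg_of_le (fun n => by positivity) (fun n => ?_)
        ((summable_geometric_of_lt_one (by positivity) hq).mul_left K)
      rw [mul_pow, ← mul_assoc]
      gcongr
      exact hu n
    calc ∑' n, u n * Real.exp t ^ n = ∑' n, ∑' k, u n * ((t * n) ^ k / (Nat.factorial k)) :=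
          tsum_congr fun n => (hexp n).tsum_eq.symm
      _ = ∑' k, ∑' n : ℕ, u n * ((t * n) ^ k / (Nat.factorial k)) := hs.tsum_comm.symm
      _ = ∑' k : ℕ, 0 := by
          refine tsum_congr fun k => ?_
          have := hm k
          calc _ = ∑' n : ℕ, (t ^ k / (Nat.factorial k)) * ((n : ℝ) ^ k * u n) :=
                tsum_congr fun n => by rw [mul_pow]; ring
            _ = 0 := by rw [tsum_mul_left, this, mul_zero]
      _ = 0 := tsum_zero
  have hev : P.sum =ᶠ[nhds 1] 0 := by
    have hc : Filter.Tendsto (fun z => |Real.log z|) (nhds 1) (nhds |Real.log 1|) :=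
      (Real.continuousAt_log one_ne_zero).abs
    rw [Real.log_one, abs_zero] at hc
    filter_upwards [hc.eventually (gt_mem_nhds (show (0 : ℝ) < - Real.log ρ by linarith)),
      lt_mem_nhds (show (0 : ℝ) < 1 by norm_num)] with z h1 h2
    have := hz _ h1
    rwa [Real.exp_log h2] at this
  have han : AnalyticOnNhd ℝ P.sum (Metric.ball 0 ρ⁻¹) := by
    refine hfp.analyticOnNhd.mono ?_
    intro z hz'
    rw [Metric.mem_eball]
    refine lt_of_lt_of_le ?_ hrad
    rw [Metric.mem_ball] at hz'
    rw [edist_dist, ENNReal.ofReal_lt_iff_lt_toReal dist_nonneg ENNReal.coe_ne_top]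
    rw [ENNReal.coe_toReal, Real.coe_toNNReal _ (inv_pos.2 hρ0).le]
    exact hz'
  have h1 : (1 : ℝ) ∈ Metric.ball (0 : ℝ) ρ⁻¹ := by
    simp only [Metric.mem_ball, dist_zero_right, norm_one]
    exact (one_lt_inv₀ hρ0).2 hρ1
  have hEq := han.eqOn_zero_of_preconnected_of_eventuallyEq_zero
    (convex_ball (0 : ℝ) ρ⁻¹).isPreconnected h1 hev
  have hev0 : P.sum =ᶠ[nhds 0] 0 :=
    Filter.eventuallyEq_of_mem (Metric.ball_mem_nhds 0 (inv_pos.2 hρ0)) hEq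
  have hP0 : P = 0 := by
    have h2 : HasFPowerSeriesAt (0 : ℝ → ℝ) P 0 := hfp.hasFPowerSeriesAt.congr hev0
    exact HasFPowerSeriesAt.eq_zero h2
  have := (FormalMultilinearSeries.ofScalars_series_eq_zero ℝ (c := u)).1 hP0
  exact congrFun this x

lemma poly_geom_summable (p : ℝ[X]) (w : ℕ → ℝ) (K ρ : ℝ) (hρ0 : 0 < ρ) (hρ1 : ρ < 1)
    (hw : ∀ x, |w x| ≤ K * ρ ^ x) : Summable fun x : ℕ => p.eval (x : ℝ) * w x := by
  induction p using Polynomial.induction_on' with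
  | add p q hp hq => simpa [add_mul] using hp.add hq
  | monomial n r =>
    have h := (summable_pow_mul_geometric_of_norm_lt_one n (r := ρ)
      (by rw [Real.norm_eq_abs, abs_of_pos hρ0]; exact hρ1)).mul_left (|r| * K)
    refine Summable.of_norm_bounded h fun x => ?_
    rw [Polynomial.eval_monomial, Real.norm_eq_abs, abs_mul, abs_mul, abs_pow, Nat.abs_cast]
    calc _ ≤ |r| * (x : ℝ) ^ n * (K * ρ ^ x) := by gcongr; exact hw x
      _ = _ := by ring

lemma weight_nonneg (w : ℕ → ℝ) (K ρ : ℝ) (hρ0 : 0 < ρ) (hρ1 : ρ < 1)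
    (hw : ∀ x, |w x| ≤ K * ρ ^ x)
    (hp : ∀ p : ℝ[X], 0 ≤ ∑' x : ℕ, (p * p).eval (x : ℝ) * w x) (x₀ : ℕ) : 0 ≤ w x₀ := by
  by_contra hneg
  push Not at hneg
  have hwabs : ∀ x, |(|w x|)| ≤ K * ρ ^ x := fun x => by rw [abs_abs]; exact hw x
  have hmem : ∀ p : ℝ[X], Memℓp (fun x : ℕ => p.eval (x : ℝ) * Real.sqrt |w x|) 2 := by
    intro p
    rw [memℓp_gen_iff (by norm_num)]
    have := poly_geom_summable (p * p) (fun x => |w x|) K ρ hρ0 hρ1 hwabs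
    refine this.congr fun x => ?_
    simp only [ENNReal.toReal_ofNat, Real.rpow_ofNat, Real.norm_eq_abs, sq_abs, mul_pow,
      Real.sq_sqrt (abs_nonneg _), Polynomial.eval_mul]
    ring
  let Φ : ℝ[X] →ₗ[ℝ] lp (fun _ : ℕ => ℝ) 2 :=
    { toFun := fun p => ⟨_, hmem p⟩
      map_add' := fun p q => by
        ext x; simp only [Polynomial.eval_add, add_mul]; rfl
      map_smul' := fun r p => by
        ext x; simp [mul_assoc] }
  have hΦ : ∀ p (x : ℕ), Φ p x = p.eval (x : ℝ) * Real.sqrt |w x| := fun p x => rfl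
  have hK : 0 ≤ K := by
    have := (abs_nonneg _).trans (hw 0); simpa using this
  have hδ : lp.single 2 x₀ (1 : ℝ) ∈ (LinearMap.range Φ).topologicalClosure := by
    rw [← Submodule.orthogonal_orthogonal_eq_closure, Submodule.mem_orthogonal]
    intro v hv
    rw [Submodule.mem_orthogonal] at hv
    have h0 : Real.sqrt |w x₀| * v x₀ = 0 := by
      refine moment_zero (fun x => Real.sqrt |w x| * v x) (Real.sqrt K * ‖v‖) (Real.sqrt ρ)
        (Real.sqrt_pos.2 hρ0) (by rw [Real.sqrt_lt' one_pos]; simpa using hρ1) ?_ ?_ x₀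
      · intro x
        rw [abs_mul, abs_of_nonneg (Real.sqrt_nonneg _)]
        have h1 : |v x| ≤ ‖v‖ := lp.norm_apply_le_norm (by norm_num) v x
        have h2 : Real.sqrt |w x| ≤ Real.sqrt K * Real.sqrt ρ ^ x := by
          refine (Real.sqrt_le_sqrt (hw x)).trans ?_
          rw [Real.sqrt_mul hK]
          gcongr
          rw [Real.sqrt_le_left (by positivity), ← pow_mul, mul_comm, pow_mul,
            Real.sq_sqrt hρ0.le]
        calc _ ≤ Real.sqrt K * Real.sqrt ρ ^ x * ‖v‖ := by gcongr
          _ = _ := by ring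
      · intro k
        have := hv (Φ (X ^ k)) ⟨_, rfl⟩
        rw [lp.inner_eq_tsum] at this
        rw [← this]
        refine tsum_congr fun x => ?_
        rw [hΦ]
        simp
        ring
    have hs : Real.sqrt |w x₀| ≠ 0 := by
      rw [Real.sqrt_ne_zero (abs_nonneg _)]
      exact abs_ne_zero.2 hneg.ne
    have hv0 : v x₀ = 0 := by simpa [hs] using h0
    rw [lp.inner_single_right]
    simp [hv0]
  rw [← SetLike.mem_coe, Submodule.topologicalClosure_coe, Metric.mem_closure_iff] at hδ
  obtain ⟨_, ⟨p, rfl⟩, hd⟩ := hδ (1 / 2) (by norm_num)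
  rw [dist_comm, dist_eq_norm] at hd
  set d := Φ p - lp.single 2 x₀ (1 : ℝ) with hdd
  have hnorm : HasSum (fun x => (d x) ^ 2) (‖d‖ ^ 2) := by
    have := lp.hasSum_norm (p := 2) (by norm_num) d
    simpa using this
  have hind : HasSum (fun x : ℕ => if x = x₀ then (1 / 2 : ℝ) else 0) (1 / 2) := by
    exact hasSum_ite_eq x₀ (1 / 2)
  have hsub := hnorm.sub hind
  have hsm := poly_geom_summable (p * p) w K ρ hρ0 hρ1 hw
  have hle := hasSum_le (fun x => ?_) hsm.hasSum hsub
  · have h1 := hp p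
    nlinarith [norm_nonneg d]
  · by_cases hx : x = x₀
    · subst hx
      have hdx : d x = p.eval (x : ℝ) * Real.sqrt |w x| - 1 := by
        rw [hdd]; simp [hΦ]
      have hsq : Real.sqrt |w x| ^ 2 = - w x := by
        rw [Real.sq_sqrt (abs_nonneg _), abs_of_neg hneg]
      rw [hdx, if_pos rfl, Polynomial.eval_mul]
      nlinarith [sq_nonneg (2 * (p.eval (x : ℝ) * Real.sqrt |w x|) - 1)]
    · have hdx : d x = p.eval (x : ℝ) * Real.sqrt |w x| := by
        rw [hdd]; simp [hΦ, hx]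
      have hsq : Real.sqrt |w x| ^ 2 = |w x| := Real.sq_sqrt (abs_nonneg _)
      rw [hdx, if_neg hx, Polynomial.eval_mul, mul_pow, hsq, sub_zero, sq]
      exact mul_le_mul_of_nonneg_left (le_abs_self _) (mul_self_nonneg _)


/-! ### Part D: Christoffel transform -/

/-- The Casorati-type determinant of Meixner polynomials at the nodes. -/
noncomputable def mW (a c : ℝ) {k : ℕ} (z : Fin k → ℝ) (n : ℕ) : ℝ :=
  Matrix.det (Matrix.of fun i j : Fin k => meixner a c (n + j) (z i))

/-- The node polynomial. -/
noncomputable def nP {k : ℕ} (z : Fin k → ℝ) : ℝ[X] := ∏ i, (X - C (z i))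

lemma nP_monic {k : ℕ} (z : Fin k → ℝ) : (nP z).Monic :=
  Polynomial.monic_prod_of_monic _ _ fun i _ => Polynomial.monic_X_sub_C _

lemma nP_natDegree {k : ℕ} (z : Fin k → ℝ) : (nP z).natDegree = k := by
  rw [nP, Polynomial.natDegree_prod_of_monic _ _ fun i _ => Polynomial.monic_X_sub_C _]
  simp

lemma nP_dvd {k : ℕ} (z : Fin k → ℝ) (hz : Function.Injective z) (Q : ℝ[X])
    (hQ : ∀ i, Q.eval (z i) = 0) : nP z ∣ Q := by
  refine Finset.prod_dvd_of_coprime ?_ fun i _ => Polynomial.dvd_iff_isRoot.2 (hQ i)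
  intro i _ j _ hij
  exact Polynomial.pairwise_coprime_X_sub_C hz hij

lemma exists_q {a c : ℝ} (ha0 : 0 < a) (ha1 : a < 1) (hc : ∀ n : ℕ, c ≠ -(n : ℝ)) {k : ℕ}
    (z : Fin k → ℝ) (hz : Function.Injective z) (n : ℕ) :
    ∃ q : ℝ[X], q.natDegree ≤ n ∧ q.coeff n = (-1) ^ k * mW a c z n / (Nat.factorial (n + k)) ∧
      ∀ r : ℝ[X], r.natDegree ≤ n → Lf a c (nP z * (q * r)) =
        mW a c z (n + 1) * ((a / (1 - a)) ^ n * r.coeff n * Lf a (c + n) 1) := by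
  set A : Matrix (Fin k) (Fin (k + 1)) ℝ := Matrix.of fun i j => meixner a c (n + j) (z i) with hA
  set cof : Fin (k + 1) → ℝ := fun j => (-1) ^ (j : ℕ) * (A.submatrix id j.succAbove).det with hcof
  have hcof0 : cof 0 = mW a c z (n + 1) := by
    simp only [hcof, Fin.val_zero, pow_zero, one_mul, mW]
    congr 1
    ext i j
    simp [hA, Fin.succAbove_zero, add_assoc, add_comm 1 (j : ℕ)]
  have hcofk : cof (Fin.last k) = (-1) ^ k * mW a c z n := by
    simp only [hcof, Fin.val_last, mW]
    congr 2
    ext i j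
    simp [hA]
  set Q : ℝ[X] := ∑ j : Fin (k + 1), C (cof j) * mP a c (n + j) with hQ
  have hroot : ∀ i, Q.eval (z i) = 0 := by
    intro i
    have hdet : (Matrix.of (Fin.cons (A i) A : Fin (k + 1) → Fin (k + 1) → ℝ)).det = 0 := by
      refine Matrix.det_zero_of_row_eq (Fin.succ_ne_zero i).symm ?_
      rfl
    rw [Matrix.det_succ_row_zero] at hdet
    rw [← hdet, hQ, Polynomial.eval_finsetSum]
    refine Finset.sum_congr rfl fun j _ => ?_
    rw [Polynomial.eval_mul, Polynomial.eval_C, mP_eval]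
    have : (Matrix.of (Fin.cons (A i) A : Fin (k + 1) → Fin (k + 1) → ℝ)).submatrix Fin.succ
        j.succAbove = A.submatrix id j.succAbove := by
      rfl
    rw [this]
    have h0 : Matrix.of (Fin.cons (A i) A : Fin (k + 1) → Fin (k + 1) → ℝ) 0 j =
        meixner a c (n + j) (z i) := rfl
    rw [h0]
    simp only [hcof]
    ring
  obtain ⟨q, hq⟩ := nP_dvd z hz Q hroot
  have hQdeg : Q.natDegree ≤ n + k := by
    refine Polynomial.natDegree_sum_le_of_forall_le _ _ fun j _ => ?_
    refine (Polynomial.natDegree_C_mul_le _ _).trans ((mP_natDegree_le a c _).trans ?_)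
    have := j.is_lt
    omega
  have hqdeg : q.natDegree ≤ n := by
    by_cases hq0 : q = 0
    · simp [hq0]
    · rw [hq, Polynomial.natDegree_mul (nP_monic z).ne_zero hq0, nP_natDegree] at hQdeg
      omega
  refine ⟨q, hqdeg, ?_, ?_⟩
  · have h1 : Q.coeff (n + k) = q.coeff n := by
      rw [hq, add_comm n k, Polynomial.coeff_mul_add_eq_of_natDegree_le (nP_natDegree z).le hqdeg]
      have := (nP_monic z).coeff_natDegree
      rw [nP_natDegree] at this
      rw [this, one_mul]
    rw [← h1, hQ, Polynomial.finsetSum_coeff, Fin.sum_univ_castSucc, Finset.sum_eq_zero, zero_add,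
      Polynomial.coeff_C_mul, Fin.val_last, mP_coeff a c ha0 ha1, hcofk]
    · ring
    · intro j _
      rw [Polynomial.coeff_C_mul, Polynomial.coeff_eq_zero_of_natDegree_lt, mul_zero]
      refine (mP_natDegree_le a c _).trans_lt ?_
      have := j.is_lt
      simp only [Fin.val_castSucc]
      omega
  · intro r hr
    rw [← mul_assoc, ← hq, hQ, Finset.sum_mul, Lf_sum ha0 ha1 hc, Fin.sum_univ_succ,
      Finset.sum_eq_zero, add_zero, mul_assoc, Lf_C_mul, hcof0]
    · simp only [Fin.val_zero, add_zero]
      rw [Lf_ortho ha0 ha1 hc n r hr]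
    · intro j _
      simp only [Fin.val_succ]
      rw [mul_assoc, Lf_C_mul, Lf_ortho ha0 ha1 hc _ r (by omega),
        Polynomial.coeff_eq_zero_of_natDegree_lt (by omega)]
      ring

lemma mW_ne {a c : ℝ} (ha0 : 0 < a) (ha1 : a < 1) (hc : ∀ n : ℕ, c ≠ -(n : ℝ)) {k : ℕ}
    (z : Fin k → ℝ) (hz : Function.Injective z)
    (hpos : ∀ p : ℝ[X], p ≠ 0 → 0 < Lf a c (nP z * (p * p))) (n : ℕ) : mW a c z n ≠ 0 := by
  intro h
  obtain ⟨v, hv0, hv⟩ := Matrix.exists_mulVec_eq_zero_iff.2 h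
  set Q : ℝ[X] := ∑ j : Fin k, C (v j) * mP a c (n + j) with hQ
  have hroot : ∀ i, Q.eval (z i) = 0 := by
    intro i
    have := congrFun hv i
    rw [Matrix.mulVec, dotProduct] at this
    simp only [Matrix.of_apply, Pi.zero_apply] at this
    rw [hQ, Polynomial.eval_finsetSum, ← this]
    refine Finset.sum_congr rfl fun j _ => ?_
    rw [Polynomial.eval_mul, Polynomial.eval_C, mP_eval, mul_comm]
  obtain ⟨r, hr⟩ := nP_dvd z hz Q hroot
  have hQ0 : Q ≠ 0 := by
    intro hQ0
    obtain ⟨j₀, hj₀⟩ := Function.ne_iff.1 hv0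
    obtain ⟨m, hm, hmax⟩ := Finset.exists_max_image (Finset.univ.filter fun j => v j ≠ 0)
      (fun j => (j : ℕ)) ⟨j₀, by simpa using hj₀⟩
    have hvm : v m ≠ 0 := by simpa using hm
    have hcoef : Q.coeff (n + m) = v m * (1 / (Nat.factorial (n + m))) := by
      rw [hQ, Polynomial.finsetSum_coeff, Finset.sum_eq_single m]
      · rw [Polynomial.coeff_C_mul, mP_coeff a c ha0 ha1]
      · intro j _ hjm
        rw [Polynomial.coeff_C_mul]
        by_cases hvj : v j = 0
        · rw [hvj, zero_mul]
        · have hle := hmax j (by simpa using hvj)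
          have : (j : ℕ) ≠ m := fun h => hjm (Fin.ext h)
          rw [Polynomial.coeff_eq_zero_of_natDegree_lt, mul_zero]
          refine (mP_natDegree_le a c _).trans_lt ?_
          omega
      · simp
    rw [hQ0, Polynomial.coeff_zero] at hcoef
    have : v m * (1 / ((Nat.factorial (n + m) : ℕ) : ℝ)) ≠ 0 := by positivity
    exact this hcoef.symm
  have hr0 : r ≠ 0 := by
    rintro rfl
    exact hQ0 (by rw [hr, mul_zero])
  have hk : 0 < k := by
    rcases Nat.eq_zero_or_pos k with rfl | h
    · exact absurd (by rw [hQ]; simp) hQ0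
    · exact h
  have hQdeg : Q.natDegree ≤ n + k - 1 := by
    refine Polynomial.natDegree_sum_le_of_forall_le _ _ fun j _ => ?_
    refine (Polynomial.natDegree_C_mul_le _ _).trans ((mP_natDegree_le a c _).trans ?_)
    have := j.is_lt
    omega
  rw [hr, Polynomial.natDegree_mul (nP_monic z).ne_zero hr0, nP_natDegree] at hQdeg
  have h1 := hpos r hr0
  rw [← mul_assoc, ← hr, hQ, Finset.sum_mul, Lf_sum ha0 ha1 hc, Finset.sum_eq_zero] at h1
  · exact lt_irrefl _ h1
  · intro j _
    rw [mul_assoc, Lf_C_mul, Lf_ortho ha0 ha1 hc _ r (by omega),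
      Polynomial.coeff_eq_zero_of_natDegree_lt (by omega)]
    ring

lemma posdef_imp {a c : ℝ} (ha0 : 0 < a) (ha1 : a < 1) (hc : ∀ n : ℕ, c ≠ -(n : ℝ)) {k : ℕ}
    (z : Fin k → ℝ) (hz : Function.Injective z)
    (hpos : ∀ p : ℝ[X], p ≠ 0 → 0 < Lf a c (nP z * (p * p))) (n : ℕ) :
    0 < (-1) ^ k * mW a c z n * mW a c z (n + 1) * Lf a (c + n) 1 := by
  obtain ⟨q, hq1, hq2, hq3⟩ := exists_q ha0 ha1 hc z hz n
  have hW := mW_ne ha0 ha1 hc z hz hpos n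
  have hq0 : q ≠ 0 := by
    rintro rfl
    rw [Polynomial.coeff_zero] at hq2
    have : (-1) ^ k * mW a c z n / ((Nat.factorial (n + k) : ℕ) : ℝ) ≠ 0 := by positivity
    exact this hq2.symm
  have h := hpos q hq0
  rw [hq3 q hq1, hq2] at h
  have ha : 0 < 1 - a := by linarith
  have h4 : 0 < (a / (1 - a)) ^ n / ((Nat.factorial (n + k) : ℕ) : ℝ) := by positivity
  refine pos_of_mul_pos_right (a := (a / (1 - a)) ^ n / ((Nat.factorial (n + k) : ℕ) : ℝ)) ?_ h4.le
  calc 0 < _ := h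
    _ = _ := by ring

lemma imp_psd {a c : ℝ} (ha0 : 0 < a) (ha1 : a < 1) (hc : ∀ n : ℕ, c ≠ -(n : ℝ)) {k : ℕ}
    (z : Fin k → ℝ) (hz : Function.Injective z)
    (hW : ∀ n, 0 < (-1) ^ k * mW a c z n * mW a c z (n + 1) * Lf a (c + n) 1) (p : ℝ[X]) :
    0 ≤ Lf a c (nP z * (p * p)) := by
  have ha : 0 < 1 - a := by linarith
  have key : ∀ n : ℕ, ∀ p : ℝ[X], p.degree < n → 0 ≤ Lf a c (nP z * (p * p)) := by
    intro n
    induction n with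
    | zero =>
      intro p hp
      have : p = 0 := by simpa using hp
      simp [this, Lf]
    | succ n ih =>
      intro p hp
      obtain ⟨q, hq1, hq2, hq3⟩ := exists_q ha0 ha1 hc z hz n
      have hWn := hW n
      have hW0 : mW a c z n ≠ 0 := by
        intro h; rw [h] at hWn; simp at hWn
      have hqn : q.coeff n ≠ 0 := by
        rw [hq2]; positivity
      have hqq : 0 ≤ Lf a c (nP z * (q * q)) := by
        rw [hq3 q hq1, hq2]
        have h4 : 0 < (a / (1 - a)) ^ n / ((Nat.factorial (n + k) : ℕ) : ℝ) := by positivity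
        calc 0 ≤ _ := (mul_pos h4 hWn).le
          _ = _ := by ring
      set t := p.coeff n / q.coeff n with ht
      set r := p - C t * q with hr
      have hpn : p.natDegree ≤ n := by
        rw [Polynomial.natDegree_le_iff_coeff_eq_zero]
        intro m hm
        exact (Polynomial.degree_lt_iff_coeff_zero p (n + 1)).1 hp m hm
      have hrn : r.natDegree ≤ n :=
        (Polynomial.natDegree_sub_le _ _).trans
          (max_le hpn ((Polynomial.natDegree_C_mul_le _ _).trans hq1))
      have hrc : r.coeff n = 0 := by
        rw [hr, Polynomial.coeff_sub, Polynomial.coeff_C_mul, ht, div_mul_cancel₀ _ hqn, sub_self]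
      have hrd : r.degree < n := by
        rw [Polynomial.degree_lt_iff_coeff_zero]
        intro m hm
        rcases hm.eq_or_lt with rfl | h
        · exact hrc
        · exact Polynomial.coeff_eq_zero_of_natDegree_lt (by omega)
      have h1 := ih r hrd
      have h2 := hq3 r hrn
      rw [hrc] at h2
      have e : nP z * (p * p) = C (t ^ 2) * (nP z * (q * q)) +
          (C (2 * t) * (nP z * (q * r)) + nP z * (r * r)) := by
        rw [hr]
        simp only [C_mul, C_pow, map_ofNat]
        ring
      rw [e, Lf_add ha0 ha1 hc, Lf_add ha0 ha1 hc, Lf_C_mul, Lf_C_mul, h2]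
      have := mul_nonneg (sq_nonneg t) hqq
      nlinarith
  exact key (p.natDegree + 1) p (by
    refine Polynomial.degree_le_natDegree.trans_lt ?_
    exact_mod_cast Nat.lt_succ_self _)

lemma weights_iff {a c : ℝ} (ha0 : 0 < a) (ha1 : a < 1) (hc : ∀ n : ℕ, c ≠ -(n : ℝ)) {k : ℕ}
    (z : Fin k → ℝ) (hz : Function.Injective z) :
    (∀ x : ℕ, 0 ≤ (nP z).eval (x : ℝ) * wt a c x) ↔
      ∀ n : ℕ, 0 < (-1) ^ k * mW a c z n * mW a c z (n + 1) * Lf a (c + n) 1 := by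
  constructor
  · intro hx
    refine posdef_imp ha0 ha1 hc z hz fun p hp => ?_
    have hnn : ∀ x : ℕ, 0 ≤ (nP z * (p * p)).eval (x : ℝ) * wt a c x := by
      intro x
      rw [Polynomial.eval_mul, Polynomial.eval_mul]
      calc 0 ≤ p.eval (x : ℝ) ^ 2 * ((nP z).eval (x : ℝ) * wt a c x) :=
            mul_nonneg (sq_nonneg _) (hx x)
        _ = _ := by ring
    have hP0 : nP z * (p * p) ≠ 0 := mul_ne_zero (nP_monic z).ne_zero (mul_ne_zero hp hp)
    obtain ⟨x, hxne⟩ : ∃ x : ℕ, (nP z * (p * p)).eval (x : ℝ) ≠ 0 := by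
      by_contra hall
      push Not at hall
      refine hP0 (Polynomial.eq_zero_of_infinite_isRoot _ ?_)
      exact (Set.infinite_range_of_injective (Nat.cast_injective (R := ℝ))).mono
        (by rintro _ ⟨x, rfl⟩; exact hall x)
    refine (wt_summable ha0 ha1 hc _).tsum_pos hnn x ?_
    exact lt_of_le_of_ne (hnn x) (mul_ne_zero hxne (wt_ne ha0 hc x)).symm
  · intro hW
    obtain ⟨K, ρ, h0, h1, hb⟩ := wt_bound ha0 ha1 hc (nP z)
    refine weight_nonneg _ K ρ h0 h1 hb fun p => ?_
    have := imp_psd ha0 ha1 hc z hz hW p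
    rw [Lf] at this
    refine this.trans_eq (tsum_congr fun x => ?_)
    rw [Polynomial.eval_mul]; ring


/-! ### Part E: the concrete nodes -/

lemma nth_orderEmb (F : Finset ℕ) (i : Fin F.card) : nth F i = F.orderEmbOfFin rfl i := by
  rw [nth, Finset.orderEmbOfFin_apply, List.getD_eq_getElem _ _ (by simp)]
  rfl

lemma nth_inj (F : Finset ℕ) {i j : ℕ} (hi : i < F.card) (hj : j < F.card)
    (h : nth F i = nth F j) : i = j := by
  have h1 := nth_orderEmb F ⟨i, hi⟩
  have h2 := nth_orderEmb F ⟨j, hj⟩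
  simp only at h1 h2
  rw [h1, h2] at h
  simpa using (F.orderEmbOfFin rfl).injective h

lemma nth_prod (F : Finset ℕ) (g : ℕ → ℝ) : ∏ i ∈ range F.card, g (nth F i) = ∏ f ∈ F, g f := by
  rw [← Fin.prod_univ_eq_prod_range (fun i => g (nth F i)) F.card]
  conv_rhs => rw [← Finset.map_orderEmbOfFin_univ F rfl, Finset.prod_map]
  refine Finset.prod_congr rfl fun i _ => ?_
  rw [nth_orderEmb]
  rfl

/-- The nodes. -/
noncomputable def nodes (c : ℝ) (F1 F2 : Finset ℕ) (i : Fin (F1.card + F2.card)) : ℝ :=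
  if (i : ℕ) < F1.card then (nth F1 i : ℝ) else -c - (nth F2 ((i : ℕ) - F1.card) : ℝ)

lemma nodes_inj (c : ℝ) (hc : ∀ n : ℕ, c ≠ -(n : ℝ)) (F1 F2 : Finset ℕ) :
    Function.Injective (nodes c F1 F2) := by
  intro i j h
  have hi := i.is_lt
  have hj := j.is_lt
  unfold nodes at h
  apply Fin.ext
  split_ifs at h with h1 h2 h2
  · exact nth_inj F1 h1 h2 (by exact_mod_cast h)
  · exact absurd (show c = -((nth F1 i + nth F2 (j - F1.card) : ℕ) : ℝ) by push_cast; linarith)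
      (hc _)
  · exact absurd (show c = -((nth F1 j + nth F2 (i - F1.card) : ℕ) : ℝ) by push_cast; linarith)
      (hc _)
  · have h3 : (nth F2 ((i : ℕ) - F1.card) : ℝ) = nth F2 ((j : ℕ) - F1.card) := by linarith
    have := nth_inj F2 (by omega) (by omega) (Nat.cast_injective h3)
    omega

lemma nodes_eval (c : ℝ) (F1 F2 : Finset ℕ) (x : ℝ) :
    (nP (nodes c F1 F2)).eval x = (∏ f ∈ F1, (x - f)) * ∏ f ∈ F2, (x + c + f) := by
  rw [nP, Polynomial.eval_prod]
  simp only [Polynomial.eval_sub, Polynomial.eval_X, Polynomial.eval_C, nodes]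
  rw [Fin.prod_univ_eq_prod_range (fun i : ℕ => x - (if i < F1.card then (nth F1 i : ℝ)
    else -c - (nth F2 (i - F1.card) : ℝ))) (F1.card + F2.card), Finset.prod_range_add,
    ← nth_prod F1 (fun f => x - f), ← nth_prod F2 (fun f => x + c + f)]
  congr 1
  · refine Finset.prod_congr rfl fun i hi => ?_
    rw [if_pos (by simpa using hi)]
  · refine Finset.prod_congr rfl fun i hi => ?_
    rw [if_neg (by omega), Nat.add_sub_cancel_left]
    ring

lemma poch_gamma {c : ℝ} (hc : ∀ n : ℕ, c ≠ -(n : ℝ)) (n : ℕ) :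
    Real.Gamma (c + n) = poch c n * Real.Gamma c := by
  induction n with
  | zero => simp [poch]
  | succ n ih =>
    have h : c + n ≠ 0 := by rw [add_comm]; exact hc_nat hc n
    rw [Nat.cast_succ, ← add_assoc, Real.Gamma_add_one h, ih, poch, poch, Finset.prod_range_succ]
    ring

lemma cf_ne {a c : ℝ} (ha0 : a ≠ 0) (ha1 : a ≠ 1) (hc : ∀ n : ℕ, c ≠ -(n : ℝ)) (n : ℕ) :
    cf a c n ≠ 0 := by
  have h1 := poch_ne c hc n
  have h2 : a - 1 ≠ 0 := sub_ne_zero.2 ha1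
  rw [cf]
  positivity

lemma mW_omega {a c : ℝ} (ha0 : 0 < a) (ha1 : a < 1) (hc : ∀ n : ℕ, c ≠ -(n : ℝ))
    (F1 F2 : Finset ℕ) : ∃ R s : ℝ, R ≠ 0 ∧ 0 < s ∧ ∀ n : ℕ, mW a c (nodes c F1 F2) n =
      R * s ^ n * (∏ j ∈ range (F1.card + F2.card), cf a c (n + j)) * OmegaM a c F1 F2 n := by
  have hai : a⁻¹ ≠ 1 := by
    intro h
    rw [inv_eq_one] at h
    exact ha1.ne h
  let R : Fin (F1.card + F2.card) → ℝ := fun i =>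
    if (i : ℕ) < F1.card then (cf a c (nth F1 i))⁻¹ else (cf a⁻¹ c (nth F2 (i - F1.card)))⁻¹
  let s : Fin (F1.card + F2.card) → ℝ := fun i => if (i : ℕ) < F1.card then 1 else a⁻¹
  refine ⟨∏ i, R i, ∏ i, s i, ?_, ?_, ?_⟩
  · rw [Finset.prod_ne_zero_iff]
    intro i _
    simp only [R]
    split_ifs
    · exact inv_ne_zero (cf_ne ha0.ne' ha1.ne hc _)
    · exact inv_ne_zero (cf_ne (inv_ne_zero ha0.ne') hai hc _)
  · refine Finset.prod_pos fun i _ => ?_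
    simp only [s]
    split_ifs <;> positivity
  · intro n
    rw [← Finset.prod_pow, ← Finset.prod_mul_distrib,
      ← Fin.prod_univ_eq_prod_range (fun j => cf a c (n + j)), OmegaM, mul_assoc,
      ← Matrix.det_mul_row, ← Matrix.det_mul_column, mW]
    congr 1
    ext i j
    simp only [Matrix.of_apply, nodes, R, s]
    split_ifs with h
    · have h1 := dual1 a c hc (n + j) (nth F1 i)
      have h2 := cf_ne ha0.ne' ha1.ne hc (nth F1 i)
      rw [one_pow, mul_one, inv_mul_eq_div, eq_div_iff h2, h1]
      push_cast
      rfl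
    · have h1 := dual2 a c ha0 ha1 hc (n + j) (nth F2 (i - F1.card))
      have h2 := cf_ne (inv_ne_zero ha0.ne') hai hc (nth F2 (i - F1.card))
      rw [mul_assoc, inv_mul_eq_div, eq_div_iff h2, h1, zpow_neg, zpow_natCast, ← inv_pow, pow_add]
      push_cast
      ring

lemma sign_omega {a c : ℝ} (ha0 : 0 < a) (ha1 : a < 1) (hc : ∀ n : ℕ, c ≠ -(n : ℝ))
    (F1 F2 : Finset ℕ) (n : ℕ) : ∃ t : ℝ, 0 < t ∧
      (-1) ^ (F1.card + F2.card) * mW a c (nodes c F1 F2) n * mW a c (nodes c F1 F2) (n + 1)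
        * Lf a (c + n) 1 =
      t * (Real.Gamma ((n : ℝ) + c + ((F1.card + F2.card : ℕ) : ℝ)) *
          OmegaM a c F1 F2 (n : ℝ) * OmegaM a c F1 F2 ((n : ℝ) + 1)) := by
  obtain ⟨R, s, hR, hs, hW⟩ := mW_omega ha0 ha1 hc F1 F2
  set k := F1.card + F2.card with hk
  set g : ℕ → ℝ := fun n => ∏ j ∈ range k, cf a c (n + j) with hg
  have hcf := cf_ne ha0.ne' ha1.ne hc
  have hg0 : ∀ n, g n ≠ 0 := fun n => Finset.prod_ne_zero_iff.2 fun j _ => hcf _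
  have hgg : g n * cf a c (n + k) = cf a c n * g (n + 1) := by
    have h1 := Finset.prod_range_succ (fun j => cf a c (n + j)) k
    have h2 := Finset.prod_range_succ' (fun j => cf a c (n + j)) k
    simp only [hg]
    rw [← h1, h2, mul_comm, add_zero]
    congr 1
    exact Finset.prod_congr rfl fun j _ => by rw [add_assoc, add_comm 1 j]
  have hL := Lf_one_pos ha0 ha1 (hc_shift hc n)
  have hG0 : Real.Gamma c ≠ 0 := by simpa using gamma_ne hc 0
  have hp := poch_ne c hc
  have e1 := poch_gamma hc n
  have e2 := poch_gamma hc (n + k)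
  have hb : 0 < a / (1 - a) := div_pos ha0 (by linarith)
  have hsg : a / (a - 1) = (-1) * (a / (1 - a)) := by
    rw [← neg_sub 1 a, div_neg]; ring
  -- the ratio of consecutive products
  have hratio : (-1) ^ k * g n * g (n + 1) = (g n / poch c n) ^ 2 * ((a / (1 - a)) ^ k *
      (Nat.factorial n) / (Nat.factorial (n + k))) * (poch c n * poch c (n + k)) := by
    have h1 : g (n + 1) = g n * cf a c (n + k) / cf a c n := by
      rw [eq_div_iff (hcf n), hgg]; ring
    have h2 : cf a c (n + k) / cf a c n = (-1) ^ k * (a / (1 - a)) ^ k * poch c (n + k) *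
        (Nat.factorial n) / ((Nat.factorial (n + k)) * poch c n) := by
      have := hp n
      rw [cf, cf, hsg, pow_add, mul_pow (-1) _ k]
      have h3 : (-1 * (a / (1 - a))) ^ n ≠ 0 := pow_ne_zero _ (by simpa using hb.ne')
      generalize (-1 * (a / (1 - a))) ^ n = y at *
      generalize (a / (1 - a)) ^ k = y' at *
      field_simp
    have h4 : ((-1 : ℝ) ^ k) * (-1) ^ k = 1 := by rw [← mul_pow]; simp
    rw [h1, mul_div_assoc, h2]
    have := hp n
    generalize (a / (1 - a)) ^ k = y' at *
    generalize (-1 : ℝ) ^ k = e at *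
    field_simp
    linear_combination (g n ^ 2 * y' * poch c (n + k)) * h4
  refine ⟨R ^ 2 * s ^ n * s ^ (n + 1) * ((g n / poch c n) ^ 2 * ((a / (1 - a)) ^ k *
      (Nat.factorial n) / (Nat.factorial (n + k)))) * (Real.Gamma (c + n) * Lf a (c + n) 1)
      / Real.Gamma c ^ 2, ?_, ?_⟩
  · have := hg0 n
    have := hp n
    positivity
  · rw [hW n, hW (n + 1), show (n : ℝ) + c + (k : ℝ) = c + ((n + k : ℕ) : ℝ) by push_cast; ring,
      e1, e2]
    calc _ = ((-1) ^ k * g n * g (n + 1)) * (R ^ 2 * s ^ n * s ^ (n + 1) *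
          OmegaM a c F1 F2 n * OmegaM a c F1 F2 ((n + 1 : ℕ) : ℝ) * Lf a (c + n) 1) := by
          simp only [hg]; ring
      _ = _ := by
          rw [hratio]
          push_cast
          field_simp

lemma weights_gamma {a c : ℝ} (ha0 : 0 < a) (A : ℝ) (x : ℕ) :
    0 ≤ A * wt a c x ↔ 0 ≤ A * Real.Gamma ((x : ℝ) + c) := by
  have h : 0 < a ^ x / ((Nat.factorial x : ℕ) : ℝ) := by positivity
  rw [wt, show A * (a ^ x * Real.Gamma (x + c) / (Nat.factorial x)) =
    (a ^ x / ((Nat.factorial x : ℕ) : ℝ)) * (A * Real.Gamma (x + c)) by ring]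
  exact mul_nonneg_iff_of_pos_left h

lemma admissible_iff {c : ℝ} (hc : ∀ n : ℕ, c ≠ -(n : ℝ)) (F1 F2 : Finset ℕ) :
    IsAdmissible c F1 F2 ↔ ∀ x : ℕ, 0 ≤ (∏ f ∈ F1, ((x : ℝ) - f)) * (∏ f ∈ F2, ((x : ℝ) + c + f)) *
      Real.Gamma ((x : ℝ) + c) := by
  refine forall_congr' fun x => ?_
  have hcx : ∀ n : ℕ, (x : ℝ) + c ≠ -(n : ℝ) := by
    rw [add_comm]; exact hc_shift hc x
  have h1 := poch_gamma hcx (chat c)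
  have hG : Real.Gamma ((x : ℝ) + c) ≠ 0 := gamma_ne hc x
  have hp := poch_ne _ hcx (chat c)
  have hpos : 0 < (x : ℝ) + c + (chat c : ℝ) := by
    have h2 : -c ≤ (chat c : ℝ) := by
      have h3 : (-⌊c⌋ : ℤ) ≤ ((chat c : ℕ) : ℤ) := Int.self_le_toNat _
      have h4 : ((-⌊c⌋ : ℤ) : ℝ) ≤ ((chat c : ℕ) : ℝ) := by exact_mod_cast h3
      have h5 := Int.floor_le c
      push_cast at h4
      linarith
    have h6 : (0 : ℝ) ≤ x := Nat.cast_nonneg x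
    rcases (show (0 : ℝ) ≤ (x : ℝ) + c + (chat c : ℝ) by linarith).lt_or_eq with h | h
    · exact h
    · exact absurd (show c = -((x + chat c : ℕ) : ℝ) by push_cast; linarith) (hc _)
  have hGp := Real.Gamma_pos_of_pos hpos
  rw [h1] at hGp
  set A := (∏ f ∈ F1, ((x : ℝ) - f)) * (∏ f ∈ F2, ((x : ℝ) + c + f))
  have e : A * Real.Gamma ((x : ℝ) + c) =
      (poch ((x : ℝ) + c) (chat c) * Real.Gamma ((x : ℝ) + c)) * (A / poch ((x : ℝ) + c) (chat c)) := by
    field_simp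
  rw [e]
  exact (mul_nonneg_iff_of_pos_left hGp).symm

/-- Lemma 4.2: for `0 < a < 1` and `c ∉ {0, -1, -2, …}`, the following are equivalent:
(1) the measure `ρ_{a,c}^𝓕` is positive; (2) `c` and `𝓕` are admissible;
(3) `Γ(n+c+k) Ω_𝓕^{a,c}(n) Ω_𝓕^{a,c}(n+1) > 0` for every `n ∈ ℕ`. -/
theorem admissibility_characterization (a c : ℝ) (ha0 : 0 < a) (ha1 : a < 1)
    (hc : ∀ n : ℕ, c ≠ -(n : ℝ))
    (F1 F2 : Finset ℕ) (hF1 : ∀ f ∈ F1, 0 < f) (hF2 : ∀ f ∈ F2, 0 < f)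
    (hne : F1.Nonempty ∨ F2.Nonempty) :
    ((∀ x : ℕ, uF F1 F2 ≤ x →
        0 ≤ (∏ f ∈ F1, ((x : ℝ) - (f : ℝ) - (uF F1 F2 : ℝ))) *
            (∏ f ∈ F2, ((x : ℝ) + c + (f : ℝ) - (uF F1 F2 : ℝ))) *
            Real.Gamma ((x : ℝ) + c - (uF F1 F2 : ℝ))) ↔
      IsAdmissible c F1 F2) ∧
    (IsAdmissible c F1 F2 ↔
      ∀ n : ℕ, 0 < Real.Gamma ((n : ℝ) + c + ((F1.card + F2.card : ℕ) : ℝ)) *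
          OmegaM a c F1 F2 (n : ℝ) * OmegaM a c F1 F2 ((n : ℝ) + 1)) := by
  constructor
  · rw [admissible_iff hc]
    constructor
    · intro h x
      have := h (x + uF F1 F2) (Nat.le_add_left _ _)
      refine this.trans_eq ?_
      push_cast
      congr 1
      · congr 1
        · exact Finset.prod_congr rfl fun f _ => by ring
        · exact Finset.prod_congr rfl fun f _ => by ring
      · congr 1; ring
    · intro h x hx
      obtain ⟨y, rfl⟩ := Nat.exists_eq_add_of_le' hx
      refine (h y).trans_eq ?_
      push_cast
      congr 1
      · congr 1
        · exact Finset.prod_congr rfl fun f _ => by ring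
        · exact Finset.prod_congr rfl fun f _ => by ring
      · congr 1; ring
  · have h1 := weights_iff ha0 ha1 hc (nodes c F1 F2) (nodes_inj c hc F1 F2)
    rw [admissible_iff hc]
    have h2 : (∀ x : ℕ, 0 ≤ (∏ f ∈ F1, ((x : ℝ) - f)) * (∏ f ∈ F2, ((x : ℝ) + c + f)) *
        Real.Gamma ((x : ℝ) + c)) ↔ ∀ x : ℕ, 0 ≤ (nP (nodes c F1 F2)).eval (x : ℝ) * wt a c x := by
      refine forall_congr' fun x => ?_
      rw [weights_gamma ha0, nodes_eval]
    rw [h2, h1]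
    refine forall_congr' fun n => ?_
    obtain ⟨t, ht, he⟩ := sign_omega ha0 ha1 hc F1 F2 n
    rw [he]
    exact mul_pos_iff_of_pos_left ht
end
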